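/- arXiv:math/0302172 — 7 statements merged into one kernel-verified Lean document; each statement's English description precedes it below -/
import Mathlib

section
/- There exists a unique polynomial g(X) ∈ ℚ[X] of degree at most n − d⊥ such that g(w) = (a_w − (q−1)·a_{w−1})·(−1)^{w−d} for every integer w with 1 ≤ w ≤ n; moreover this polynomial g has degree exactly n − d⊥. -/
open Finset Polynomial

noncomputable section

variable {F : Type*} [Field F] [Fintype F] {ι : Type*} [Fintype ι]

/-- Hamming weight of a vector. -/
def wt (x : ι → F) : ℕ := Set.ncard {i | x i ≠ 0}

/-- The dual code with respect to the standard bilinear form. -/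
def dualCode (Γ : Submodule F (ι → F)) : Submodule F (ι → F) where
  carrier := {x | ∀ c ∈ Γ, ∑ i, x i * c i = 0}
  zero_mem' := by intro c hc; simp
  add_mem' := by
    intro a b ha hb c hc
    simp [Pi.add_apply, add_mul, Finset.sum_add_distrib, ha c hc, hb c hc]
  smul_mem' := by
    intro r a ha c hc
    simp [Pi.smul_apply, smul_eq_mul, mul_assoc, ← Finset.mul_sum, ha c hc]

/-- Minimum distance: the least Hamming weight of a nonzero codeword. -/
def minDist (Γ : Submodule F (ι → F)) : ℕ := sInf {w | ∃ x ∈ Γ, x ≠ 0 ∧ wt x = w}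

/-- Number of codewords of weight `i`. -/
def wtCount (Γ : Submodule F (ι → F)) (i : ℕ) : ℕ := Set.ncard {x | x ∈ Γ ∧ wt x = i}

/-- Vectors supported inside a set `S` of coordinates. -/
def supportedOn (F : Type*) [Field F] {ι : Type*} (S : Finset ι) : Submodule F (ι → F) where
  carrier := {x | ∀ i ∉ S, x i = 0}
  zero_mem' := by intro i hi; rfl
  add_mem' := by intro a b ha hb i hi; simp [Pi.add_apply, ha i hi, hb i hi]
  smul_mem' := by intro r a ha i hi; simp [Pi.smul_apply, ha i hi]

/-- The rank function: dimension of the projection of the code to coordinates in `S`. -/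
def projRank (Γ : Submodule F (ι → F)) (S : Finset ι) : ℕ :=
  Module.finrank F (Γ.map (LinearMap.funLeft F F (Subtype.val : {i // i ∈ S} → ι)))

/-- Generalized binomial coefficient `x(x-1)⋯(x-m+1)/m!`. -/
def genBinom (x : ℚ) (m : ℕ) : ℚ := (descPochhammer ℚ m).eval x / m.factorial

/-- The congruence defining the zeta polynomial of a code. -/
def zetaCongr (q n d : ℕ) (a : ℕ → ℚ) (P : ℚ[X]) : Prop :=
  (X : ℚ[X]) ^ (n - d + 1) ∣
    P * (1 - X) ^ n -
      (1 - Polynomial.C (q : ℚ) * X) * Polynomial.C (((q : ℚ) - 1)⁻¹) *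
        ∑ w ∈ Finset.Icc d n, Polynomial.C (a w) * X ^ (w - d) * (1 - X) ^ (n - w)

/-- `P` is the zeta polynomial of a code with parameters `q, n, d` and
normalized weights `a`. -/
def IsZetaPoly (q n d : ℕ) (a : ℕ → ℚ) (P : ℚ[X]) : Prop :=
  P.natDegree ≤ n - d ∧ zetaCongr q n d a P

lemma aux_finrank_dual {F : Type*} [Field F] [Fintype F] {n : ℕ}
    (W : Submodule F (Fin n → F)) :
    Module.finrank F W + Module.finrank F (dualCode W) = n := by
  have h1 := Subspace.finrank_add_finrank_dualAnnihilator_eq W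
  have h2 : (dualCode W).map (dotProductEquiv F (Fin n)).toLinearMap = W.dualAnnihilator := by
    ext φ
    rw [Submodule.mem_dualAnnihilator, Submodule.mem_map]
    constructor
    · rintro ⟨x, hx, rfl⟩ c hc
      exact hx c hc
    · intro h
      refine ⟨(dotProductEquiv F (Fin n)).symm φ, ?_, by simp⟩
      intro c hc
      have h3 := h c hc
      have h4 : φ = dotProductEquiv F (Fin n) ((dotProductEquiv F (Fin n)).symm φ) := by simp
      rw [h4] at h3
      exact h3
  have h3 := LinearEquiv.finrank_map_eq (dotProductEquiv F (Fin n)) (dualCode W)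
  rw [← h2] at h1
  simp only [Module.finrank_fin_fun] at h1
  rw [← h3]
  exact h1

lemma aux_dual_sup {F : Type*} [Field F] [Fintype F] {n : ℕ}
    (W : Submodule F (Fin n → F)) (S : Finset (Fin n)) :
    dualCode (W ⊔ supportedOn F S) = dualCode W ⊓ supportedOn F Sᶜ := by
  ext x
  constructor
  · intro hx
    refine ⟨fun c hc => hx c (Submodule.mem_sup_left hc), fun i hi => ?_⟩
    have h := hx (Pi.single i 1) (Submodule.mem_sup_right (fun j hj => ?_))
    · simpa [Pi.single_apply] using h
    · have : j ≠ i := by rintro rfl; simp at hi; exact hj hi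
      simp [this]
  · rintro ⟨h1, h2⟩ c hc
    obtain ⟨y, hy, z, hz, rfl⟩ := Submodule.mem_sup.1 hc
    have e1 := h1 y hy
    have e2 : ∑ i, x i * z i = 0 := by
      apply Finset.sum_eq_zero
      intro i _
      by_cases hi : i ∈ S
      · rw [h2 i (by simpa using hi), zero_mul]
      · rw [hz i hi, mul_zero]
    simp [mul_add, Finset.sum_add_distrib, e1, e2]

lemma aux_finrank_supp {F : Type*} [Field F] [Fintype F] {n : ℕ} (S : Finset (Fin n)) :
    Module.finrank F (supportedOn F S) = S.card := by
  classical
  let e : supportedOn F S ≃ₗ[F] (S → F) :=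
    { toFun := fun x i => x.1 i.1
      map_add' := fun _ _ => rfl
      map_smul' := fun _ _ => rfl
      invFun := fun f => ⟨fun i => if h : i ∈ S then f ⟨i, h⟩ else 0, fun i hi => by simp [hi]⟩
      left_inv := by
        intro x
        ext i
        by_cases hi : i ∈ S
        · simp [hi]
        · simp [hi, x.2 i hi]
      right_inv := by
        intro f
        ext i
        simp }
  rw [e.finrank_eq]
  simp

/-- Number of codewords supported in `S`. -/
def numSupp {F : Type*} [Field F] {n : ℕ} (W : Submodule F (Fin n → F)) (S : Finset (Fin n)) : ℕ :=
  Nat.card ↥(W ⊓ supportedOn F S)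

lemma aux_numSupp {F : Type*} [Field F] [Fintype F] {n : ℕ}
    (W : Submodule F (Fin n → F)) (S : Finset (Fin n)) :
    numSupp W S * Fintype.card F ^ n =
      Fintype.card F ^ (Module.finrank F W + S.card) * numSupp (dualCode W) Sᶜ := by
  unfold numSupp
  rw [Module.natCard_eq_pow_finrank (K := F) (V := ↥(W ⊓ supportedOn F S)),
    Module.natCard_eq_pow_finrank (K := F) (V := ↥(dualCode W ⊓ supportedOn F Sᶜ)),
    Nat.card_eq_fintype_card, ← pow_add, ← pow_add, ← aux_dual_sup]
  congr 1
  have h1 := aux_finrank_dual (W ⊔ supportedOn F S)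
  have h2 := Submodule.finrank_sup_add_finrank_inf_eq W (supportedOn F S)
  rw [aux_finrank_supp] at h2
  omega

/-- Average number of codewords supported in an `s`-subset. -/
def bavg {F : Type*} [Field F] {n : ℕ} (W : Submodule F (Fin n → F)) (s : ℕ) : ℚ :=
  (∑ S ∈ powersetCard s (univ : Finset (Fin n)), (numSupp W S : ℚ)) / n.choose s

open Classical in
lemma aux_wt {F : Type*} [Field F] [Fintype F] {n : ℕ} (x : Fin n → F) :
    wt x = (univ.filter (fun i => x i ≠ 0)).card := by
  unfold wt
  rw [← Set.ncard_coe_finset]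
  congr 1
  ext; simp

open Classical in
lemma aux_count {n s : ℕ} (hs : s ≤ n) (T : Finset (Fin n)) :
    ((((powersetCard s (univ : Finset (Fin n))).filter (T ⊆ ·)).card : ℕ) : ℚ) / n.choose s
      = (s.choose T.card : ℚ) / n.choose T.card := by
  have hT : T.card ≤ n := by simpa using card_le_univ T
  have h0 : (n.choose s : ℚ) ≠ 0 := by exact_mod_cast (Nat.choose_pos hs).ne'
  have h1 : (n.choose T.card : ℚ) ≠ 0 := by exact_mod_cast (Nat.choose_pos hT).ne'
  by_cases h : T.card ≤ s
  · rw [card_filter_powersetCard_subset _ _ _ (subset_univ _) h, div_eq_div_iff h0 h1]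
    have := Nat.choose_mul (n := n) h
    simp only [card_univ, Fintype.card_fin]
    exact_mod_cast (by linarith : (n - #T).choose (s - #T) * n.choose #T = s.choose #T * n.choose s)
  · rw [filter_eq_empty_iff.2, Nat.choose_eq_zero_of_lt (by omega : s < T.card)]
    · simp
    · intro S hS hTS
      have := card_le_card hTS
      rw [(mem_powersetCard.1 hS).2] at this
      exact h this

open Classical in
lemma aux_bavg {F : Type*} [Field F] [Fintype F] {n : ℕ}
    (W : Submodule F (Fin n → F)) {s : ℕ} (hs : s ≤ n) :
    bavg W s = ∑ i ∈ range (n + 1), (s.choose i : ℚ) * ((wtCount W i : ℚ) / n.choose i) := by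
  let G : Finset (Fin n → F) := univ.filter (· ∈ W)
  have hN : ∀ S, numSupp W S = (G.filter (fun x => univ.filter (fun i => x i ≠ 0) ⊆ S)).card := by
    intro S
    unfold numSupp
    rw [← Set.ncard_coe_finset, ← Nat.card_coe_set_eq]
    apply Nat.card_congr
    apply Equiv.subtypeEquivRight
    intro x
    simp only [G, coe_filter, mem_filter, mem_univ, true_and, Submodule.mem_inf, Set.mem_ofPred_eq,
      Finset.subset_iff]
    apply and_congr Iff.rfl
    constructor
    · intro h i hi
      by_contra h'
      exact hi (h i h')
    · intro h i hi
      by_contra h'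
      exact hi (h h')
  have hA : ∀ i, wtCount W i = (G.filter (fun x => wt x = i)).card := by
    intro i
    unfold wtCount
    rw [← Set.ncard_coe_finset]
    congr 1
    ext; simp [G]
  have h1 : bavg W s = ∑ x ∈ G, (s.choose (wt x) : ℚ) / n.choose (wt x) := by
    unfold bavg
    simp only [hN, card_filter, Nat.cast_sum]
    rw [sum_comm, sum_div]
    refine sum_congr rfl fun x _ => ?_
    rw [← Nat.cast_sum, ← card_filter, aux_wt]
    exact aux_count hs _
  rw [h1, ← sum_fiberwise_of_maps_to (s := G) (t := range (n + 1)) (g := wt)]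
  · refine sum_congr rfl fun i _ => ?_
    rw [sum_congr rfl (g := fun _ => (s.choose i : ℚ) / n.choose i)]
    · rw [sum_const, hA, nsmul_eq_mul]; ring
    · intro x hx
      rw [(mem_filter.1 hx).2]
  · intro x _
    rw [mem_range, aux_wt]
    have := card_le_univ (univ.filter (fun i => x i ≠ 0))
    simp at this
    simp
    omega

/-- Newton-type inversion. -/
lemma aux_newton (n : ℕ) (a b : ℕ → ℚ) (q : ℚ)
    (hb : ∀ s ≤ n, b s = ∑ i ∈ range (n + 1), (s.choose i : ℚ) * a i)
    (m : ℕ) (hm : m + 1 ≤ n) :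
    a (m + 1) - (q - 1) * a m =
      ∑ s ∈ range (m + 1), (m.choose s : ℚ) * (-1) ^ (m - s) * (b (s + 1) - q * b s) := by
  let L : ℚ[X] →ₗ[ℚ] ℚ := ∑ i ∈ range (n + 1), a i • Polynomial.lcoeff ℚ i
  have hL : ∀ p, L p = ∑ i ∈ range (n + 1), a i * p.coeff i := by
    intro p; simp [L]
  have hX : ∀ w ≤ n, L (X ^ w) = a w := by
    intro w hw
    rw [hL]
    simp only [coeff_X_pow, mul_ite, mul_one, mul_zero]
    rw [Finset.sum_ite_eq', if_pos (by simp; omega)]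
  have hY : ∀ s ≤ n, L ((X + 1) ^ s) = b s := by
    intro s hs
    rw [hL, hb s hs]
    refine sum_congr rfl fun i _ => ?_
    rw [coeff_X_add_one_pow, mul_comm]
  have key : (X : ℚ[X]) ^ (m + 1) - (q - 1) • X ^ m =
      ∑ s ∈ range (m + 1), ((m.choose s : ℚ) * (-1) ^ (m - s)) •
        ((X + 1) ^ (s + 1) - q • (X + 1) ^ s) := by
    have e : (X : ℚ[X]) ^ m = ((X + 1) + (-1)) ^ m := by ring
    have e2 : (X : ℚ[X]) ^ (m + 1) - (q - 1) • X ^ m = X ^ m * ((X + 1) - C q) := by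
      rw [smul_eq_C_mul]; simp only [C_sub, C_1]; ring
    rw [e2, e, add_pow, sum_mul]
    refine sum_congr rfl fun s _ => ?_
    simp only [smul_eq_C_mul, C_mul, C_pow, C_neg, C_1, map_natCast]
    ring
  have := congrArg L key
  rw [map_sub, map_smul, map_sum, hX _ hm, hX _ (by omega), smul_eq_mul] at this
  rw [this]
  refine sum_congr rfl fun s hs => ?_
  have hs := mem_range.1 hs
  rw [map_smul, map_sub, map_smul, hY _ (by omega), hY _ (by omega), smul_eq_mul, smul_eq_mul]

lemma aux_minDist {F : Type*} [Field F] [Fintype F] {n : ℕ}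
    (W : Submodule F (Fin n → F)) (hW : 0 < Module.finrank F W) :
    1 ≤ minDist W ∧ minDist W ≤ n ∧ (∃ x ∈ W, x ≠ 0 ∧ wt x = minDist W) ∧
      ∀ x ∈ W, x ≠ 0 → minDist W ≤ wt x := by
  classical
  have hne : ({w | ∃ x ∈ W, x ≠ 0 ∧ wt x = w} : Set ℕ).Nonempty := by
    have : W ≠ ⊥ := by rintro rfl; simp at hW
    obtain ⟨x, hx, hx0⟩ := W.exists_mem_ne_zero_of_ne_bot this
    exact ⟨wt x, x, hx, hx0, rfl⟩
  have h1 : ∃ x ∈ W, x ≠ 0 ∧ wt x = minDist W := Nat.sInf_mem hne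
  refine ⟨?_, ?_, h1, fun x hx hx0 => Nat.sInf_le ⟨x, hx, hx0, rfl⟩⟩
  · obtain ⟨x, _, hx0, hw⟩ := h1
    rw [← hw, aux_wt]
    obtain ⟨i, hi⟩ := Function.ne_iff.1 hx0
    exact card_pos.2 ⟨i, by simpa using hi⟩
  · obtain ⟨x, _, hx0, hw⟩ := h1
    rw [← hw, aux_wt]
    simpa using card_le_univ (univ.filter (fun i => x i ≠ 0))

lemma aux_numSupp_one {F : Type*} [Field F] [Fintype F] {n : ℕ}
    (W : Submodule F (Fin n → F)) (hW : 0 < Module.finrank F W) (S : Finset (Fin n))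
    (hS : S.card < minDist W) : numSupp W S = 1 := by
  classical
  have : W ⊓ supportedOn F S = ⊥ := by
    rw [eq_bot_iff]
    rintro x ⟨hx, hx'⟩
    by_contra h0
    have h1 := (aux_minDist W hW).2.2.2 x hx h0
    have h2 : wt x ≤ S.card := by
      rw [aux_wt]
      apply card_le_card
      intro i hi
      by_contra h'
      exact (mem_filter.1 hi).2 (hx' i h')
    omega
  unfold numSupp
  rw [this]
  simp

lemma aux_numSupp_pos {F : Type*} [Field F] [Fintype F] {n : ℕ}
    (W : Submodule F (Fin n → F)) (S : Finset (Fin n)) : 1 ≤ numSupp W S :=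
  Nat.card_pos

lemma aux_numSupp_gt {F : Type*} [Field F] [Fintype F] {n : ℕ}
    (W : Submodule F (Fin n → F)) (hW : 0 < Module.finrank F W) :
    ∃ S : Finset (Fin n), S.card = minDist W ∧ 1 < numSupp W S := by
  classical
  obtain ⟨x, hx, hx0, hw⟩ := (aux_minDist W hW).2.2.1
  refine ⟨univ.filter (fun i => x i ≠ 0), by rw [← hw, aux_wt], ?_⟩
  unfold numSupp
  have hm : x ∈ W ⊓ supportedOn F (univ.filter (fun i => x i ≠ 0)) :=
    ⟨hx, fun i hi => by simpa using hi⟩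
  rw [Finite.one_lt_card_iff_nontrivial]
  exact ⟨⟨x, hm⟩, 0, fun h => hx0 (congrArg Subtype.val h)⟩

lemma aux_bavg_dual {F : Type*} [Field F] [Fintype F] {n : ℕ}
    (W : Submodule F (Fin n → F)) (hW : 0 < Module.finrank F (dualCode W)) :
    (∀ s ≤ n, n < s + minDist (dualCode W) → bavg W s * (Fintype.card F : ℚ) ^ n =
        (Fintype.card F : ℚ) ^ (Module.finrank F W + s)) ∧
    (Fintype.card F : ℚ) ^ (Module.finrank F W + (n - minDist (dualCode W))) <
      bavg W (n - minDist (dualCode W)) * (Fintype.card F : ℚ) ^ n := by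
  have hq : (0 : ℚ) < Fintype.card F := by exact_mod_cast Fintype.card_pos
  have h : ∀ s ≤ n, bavg W s * (Fintype.card F : ℚ) ^ n =
      (Fintype.card F : ℚ) ^ (Module.finrank F W + s) *
      ((∑ S ∈ powersetCard s (univ : Finset (Fin n)), (numSupp (dualCode W) Sᶜ : ℚ))
        / n.choose s) := by
    intro s hs
    unfold bavg
    rw [div_mul_eq_mul_div, mul_div_assoc', sum_mul, mul_sum]
    congr 1
    refine sum_congr rfl fun S hS => ?_
    have := aux_numSupp W S
    rw [(mem_powersetCard.1 hS).2] at this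
    exact_mod_cast this
  constructor
  · intro s hs hsn
    have h0 : (n.choose s : ℚ) ≠ 0 := by exact_mod_cast (Nat.choose_pos hs).ne'
    rw [h s hs, sum_congr rfl (g := fun _ => (1 : ℚ))]
    · simp [h0]
    · intro S hS
      rw [aux_numSupp_one _ hW]
      · simp
      · rw [card_compl, (mem_powersetCard.1 hS).2]
        simp
        omega
  · have hs : n - minDist (dualCode W) ≤ n := Nat.sub_le _ _
    have hd := (aux_minDist _ hW).2.1
    have h0 : (0 : ℚ) < (n.choose (n - minDist (dualCode W)) : ℚ) := by
      exact_mod_cast (Nat.choose_pos hs)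
    rw [h _ hs]
    apply lt_mul_of_one_lt_right (by positivity)
    rw [lt_div_iff₀ h0, one_mul]
    obtain ⟨T, hT, hT1⟩ := aux_numSupp_gt _ hW
    calc (n.choose (n - minDist (dualCode W)) : ℚ)
        = ∑ S ∈ powersetCard (n - minDist (dualCode W)) (univ : Finset (Fin n)), (1 : ℚ) := by
          simp
      _ < _ := by
          apply sum_lt_sum
          · intro S _
            exact_mod_cast aux_numSupp_pos _ _
          · refine ⟨Tᶜ, mem_powersetCard.2 ⟨subset_univ _, ?_⟩, ?_⟩
            · rw [card_compl, hT]; simp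
            · rw [compl_compl]; exact_mod_cast hT1

/-- The binomial polynomial `binom(X-1, s)`. -/
def binPoly (s : ℕ) : ℚ[X] := C ((s.factorial : ℚ)⁻¹) * (descPochhammer ℚ s).comp (X - 1)

lemma aux_binPoly_eval (s m : ℕ) : (binPoly s).eval ((m + 1 : ℕ) : ℚ) = (m.choose s : ℚ) := by
  unfold binPoly
  have h : (s.factorial : ℚ) ≠ 0 := by exact_mod_cast s.factorial_ne_zero
  simp only [eval_mul, eval_C, eval_comp, eval_sub, eval_X, eval_one, Nat.cast_add, Nat.cast_one,
    add_sub_cancel_right]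
  rw [descPochhammer_eval_eq_descFactorial, Nat.descFactorial_eq_factorial_mul_choose]
  push_cast
  field_simp

lemma aux_binPoly_natDegree (s : ℕ) : (binPoly s).natDegree = s := by
  unfold binPoly
  have h : (s.factorial : ℚ)⁻¹ ≠ 0 := inv_ne_zero (by exact_mod_cast s.factorial_ne_zero)
  rw [natDegree_C_mul h, natDegree_comp, descPochhammer_natDegree]
  have : (X - 1 : ℚ[X]).natDegree = 1 := natDegree_X_sub_C (1 : ℚ)
  rw [this, mul_one]

lemma aux_sum_natDegree (m : ℕ) (c : ℕ → ℚ) (hc : c m ≠ 0) :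
    (∑ s ∈ range (m + 1), C (c s) * binPoly s).natDegree = m := by
  rw [sum_range_succ]
  have h1 : (C (c m) * binPoly m).natDegree = m := by
    rw [natDegree_C_mul hc, aux_binPoly_natDegree]
  rcases Nat.eq_zero_or_pos m with rfl | hm
  · simpa using h1
  · rw [natDegree_add_eq_right_of_natDegree_lt, h1]
    rw [h1]
    apply lt_of_le_of_lt (natDegree_sum_le_of_forall_le (n := m - 1) _ _ _) (by omega)
    intro s hs
    have := mem_range.1 hs
    refine (natDegree_C_mul_le _ _).trans ?_
    rw [aux_binPoly_natDegree]
    omega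

/-- There exists a unique polynomial `g ∈ ℚ[X]` of degree at most
`n - d⊥` interpolating the signed normalized differences, and it has degree
exactly `n - d⊥`. -/
theorem stmt_0 {F : Type*} [Field F] [Fintype F] {n : ℕ}
    (Γ : Submodule F (Fin n → F))
    (hk0 : 0 < Module.finrank F Γ) (hkn : Module.finrank F Γ < n)
    (q d d' : ℕ) (hq : q = Fintype.card F)
    (hd : d = minDist Γ) (hd' : d' = minDist (dualCode Γ))
    (a : ℕ → ℚ) (ha : ∀ w, a w = (wtCount Γ w : ℚ) / (n.choose w)) :
    (∃! g : ℚ[X], g.natDegree ≤ n - d' ∧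
        ∀ w : ℕ, 1 ≤ w → w ≤ n →
          g.eval (w : ℚ) =
            (a w - ((q : ℚ) - 1) * a (w - 1)) * (-1 : ℚ) ^ ((w : ℤ) - (d : ℤ))) ∧
    ∀ g : ℚ[X],
      (g.natDegree ≤ n - d' ∧
        ∀ w : ℕ, 1 ≤ w → w ≤ n →
          g.eval (w : ℚ) =
            (a w - ((q : ℚ) - 1) * a (w - 1)) * (-1 : ℚ) ^ ((w : ℤ) - (d : ℤ))) →
      g.natDegree = n - d' := by
  have hdim := aux_finrank_dual Γ
  have hW : 0 < Module.finrank F (dualCode Γ) := by omega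
  obtain ⟨hd1, hdn, -, -⟩ := aux_minDist _ hW
  obtain ⟨hb1, hb2⟩ := aux_bavg_dual Γ hW
  rw [← hd'] at hd1 hdn hb1 hb2
  rw [← hq] at hb1 hb2
  have hq0 : (0 : ℚ) < q := by rw [hq]; exact_mod_cast Fintype.card_pos
  have hqn : (0 : ℚ) < (q : ℚ) ^ n := by positivity
  have hb : ∀ s ≤ n, bavg Γ s = ∑ i ∈ range (n + 1), (s.choose i : ℚ) * a i := by
    intro s hs
    rw [aux_bavg Γ hs]
    simp only [ha]
  have hnew := aux_newton n a (bavg Γ) q hb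
  have he0 : ∀ s, s + 1 ≤ n → n - d' < s → bavg Γ (s + 1) - q * bavg Γ s = 0 := by
    intro s hs1 hs2
    have e1 := hb1 (s + 1) hs1 (by omega)
    have e2 := hb1 s (by omega) (by omega)
    have : (bavg Γ (s + 1) - q * bavg Γ s) * (q : ℚ) ^ n = 0 := by
      rw [sub_mul, mul_assoc, e1, e2]; ring
    exact (mul_eq_zero.1 this).resolve_right hqn.ne'
  have he1 : bavg Γ (n - d' + 1) - q * bavg Γ (n - d') ≠ 0 := by
    intro h
    have e1 := hb1 (n - d' + 1) (by omega) (by omega)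
    rw [sub_eq_zero.1 h, mul_assoc] at e1
    have := mul_lt_mul_of_pos_left hb2 hq0
    rw [e1, ← add_assoc, pow_succ, mul_comm] at this
    exact lt_irrefl _ this
  let c : ℕ → ℚ := fun s =>
    (-1) ^ (d + 1 + s) * (bavg Γ (s + 1) - q * bavg Γ s)
  let g : ℚ[X] := ∑ s ∈ range (n - d' + 1), C (c s) * binPoly s
  have hgdeg : g.natDegree = n - d' :=
    aux_sum_natDegree _ c (mul_ne_zero (pow_ne_zero _ (by norm_num)) he1)
  have hsgn : ∀ w : ℕ, (-1 : ℚ) ^ ((w : ℤ) - (d : ℤ)) = (-1) ^ (w + d) := by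
    intro w
    rw [zpow_sub₀ (by norm_num), zpow_natCast, zpow_natCast, pow_add, div_eq_iff
      (pow_ne_zero _ (by norm_num)), mul_assoc, ← pow_add, ← two_mul, pow_mul]
    simp
  have hgev : ∀ w : ℕ, 1 ≤ w → w ≤ n → g.eval (w : ℚ) =
      (a w - ((q : ℚ) - 1) * a (w - 1)) * (-1 : ℚ) ^ ((w : ℤ) - (d : ℤ)) := by
    intro w hw1 hwn
    obtain ⟨m, rfl⟩ : ∃ m, w = m + 1 := ⟨w - 1, by omega⟩
    rw [hsgn, Nat.add_sub_cancel, hnew m hwn, sum_mul]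
    simp only [g, eval_finsetSum, eval_mul, eval_C, aux_binPoly_eval]
    have z1 : ∑ s ∈ range (n - d' + 1), c s * (m.choose s : ℚ) =
        ∑ s ∈ range n, c s * (m.choose s : ℚ) := by
      apply sum_subset
      · intro s; simp only [mem_range]; omega
      · intro s h1 h2
        simp only [mem_range] at h1 h2
        simp only [c]
        rw [he0 s (by omega) (by omega)]
        simp
    have z2 : ∑ s ∈ range (m + 1), c s * (m.choose s : ℚ) =
        ∑ s ∈ range n, c s * (m.choose s : ℚ) := by
      apply sum_subset
      · intro s; simp only [mem_range]; omega
      · intro s h1 h2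
        simp only [mem_range] at h1 h2
        rw [Nat.choose_eq_zero_of_lt (by omega : m < s)]
        simp
    rw [z1, ← z2]
    refine sum_congr rfl fun s hs => ?_
    have hs := mem_range.1 hs
    obtain ⟨t, rfl⟩ : ∃ t, m = s + t := ⟨m - s, by omega⟩
    have e : (-1 : ℚ) ^ (s + t - s) * (-1) ^ (s + t + 1 + d) = (-1) ^ (d + 1 + s) := by
      rw [Nat.add_sub_cancel_left, ← pow_add,
        show t + (s + t + 1 + d) = 2 * t + (d + 1 + s) by ring, pow_add, pow_mul]
      simp
    simp only [c]
    rw [← e]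
    ring
  have huniq : ∀ p : ℚ[X], (p.natDegree ≤ n - d' ∧
        ∀ w : ℕ, 1 ≤ w → w ≤ n →
          p.eval (w : ℚ) =
            (a w - ((q : ℚ) - 1) * a (w - 1)) * (-1 : ℚ) ^ ((w : ℤ) - (d : ℤ))) → p = g := by
    rintro p ⟨hp1, hp2⟩
    apply eq_of_natDegree_lt_card_of_eval_eq p g (ι := Fin n) (f := fun i => ((i.1 + 1 : ℕ) : ℚ))
    · intro i j hij
      simp only at hij
      have : i.1 + 1 = j.1 + 1 := by exact_mod_cast hij
      ext; omega
    · intro i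
      rw [hp2 _ (by omega) (by omega), hgev _ (by omega) (by omega)]
    · rw [hgdeg, Fintype.card_fin, max_lt_iff]
      omega
  refine ⟨⟨g, ⟨hgdeg.le, hgev⟩, huniq⟩, fun p hp => ?_⟩
  rw [huniq p hp, hgdeg]

end
end

section
/- If d + d⊥ = n + 2, then for every integer w with 1 ≤ w ≤ n one has a_w − (q−1)·a_{w−1} = (−1)^{w−d}·(q−1)·B(w−2, d−2), where B(x, m) denotes the generalized binomial coefficient x(x−1)⋯(x−m+1)/m! evaluated at the integer x = w−2 with m = d−2. -/
open Finset Polynomial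

noncomputable section

variable {F : Type*} [Field F] [Fintype F] {ι : Type*} [Fintype ι]

theorem finrank_supportedOn' {F : Type*} [Field F] {ι : Type*} [Fintype ι] (S : Finset ι) :
    Module.finrank F (supportedOn F S) = S.card := by
  classical
  let e : supportedOn F S ≃ₗ[F] (S → F) :=
    { toFun := fun x i => x.1 i
      map_add' := fun x y => rfl
      map_smul' := fun r x => rfl
      invFun := fun y => ⟨fun i => if h : i ∈ S then y ⟨i, h⟩ else 0, fun i hi => by simp [hi]⟩
      left_inv := by
        intro x
        ext i
        by_cases h : i ∈ S
        · simp [h]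
        · simp [h, x.2 i h]
      right_inv := by
        intro y
        ext i
        simp }
  rw [e.finrank_eq]
  simp

theorem wt_le_of_supportedOn {F : Type*} [Field F] {ι : Type*} [Fintype ι] (S : Finset ι)
    (x : ι → F) (hx : x ∈ supportedOn F S) : wt x ≤ S.card := by
  rw [wt, ← Set.ncard_coe_finset]
  apply Set.ncard_le_ncard _ (Finset.finite_toSet S)
  intro i hi
  by_contra h
  exact hi (hx i h)

theorem inf_supportedOn_eq_bot {F : Type*} [Field F] {ι : Type*} [Fintype ι]
    (Γ : Submodule F (ι → F)) (S : Finset ι) (hS : S.card < minDist Γ) :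
    Γ ⊓ supportedOn F S = ⊥ := by
  rw [Submodule.eq_bot_iff]
  intro x hx
  by_contra h0
  have h1 : minDist Γ ≤ wt x := Nat.sInf_le ⟨x, hx.1, h0, rfl⟩
  have := wt_le_of_supportedOn S x hx.2
  omega

theorem minDist_le_card {F : Type*} [Field F] {n : ℕ}
    (Γ : Submodule F (Fin n → F)) (h : 0 < Module.finrank F Γ) : minDist Γ ≤ n := by
  have hne : Γ ≠ ⊥ := by
    rintro rfl
    simp at h
  obtain ⟨x, hx, hx0⟩ := Submodule.exists_mem_ne_zero_of_ne_bot hne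
  have h1 : minDist Γ ≤ wt x := Nat.sInf_le ⟨x, hx, hx0, rfl⟩
  have := wt_le_of_supportedOn (Finset.univ) x (fun i hi => by simp at hi)
  simp at this
  omega

theorem singleton_bound {F : Type*} [Field F] {n : ℕ}
    (Γ : Submodule F (Fin n → F)) (d : ℕ) (hd : d + 1 = minDist Γ) (hn : d ≤ n) :
    Module.finrank F Γ + d ≤ n := by
  obtain ⟨T, -, hT⟩ := Finset.exists_subset_card_eq (s := (Finset.univ : Finset (Fin n)))
    (n := d) (by simpa using hn)
  have h1 := Submodule.finrank_sup_add_finrank_inf_eq Γ (supportedOn F T)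
  rw [inf_supportedOn_eq_bot Γ T (by omega), finrank_supportedOn', finrank_bot, hT] at h1
  have h2 := Submodule.finrank_le (Γ ⊔ supportedOn F T)
  simp at h2
  omega

theorem finrank_dualCode_ge {F : Type*} [Field F] {n : ℕ}
    (Γ : Submodule F (Fin n → F)) :
    n ≤ Module.finrank F (dualCode Γ) + Module.finrank F Γ := by
  let f : (Fin n → F) →ₗ[F] (Γ →ₗ[F] F) :=
    LinearMap.mk₂ F (fun x c => ∑ i, x i * c.1 i)
      (by intros; simp [add_mul, Finset.sum_add_distrib])
      (by intros; simp [mul_assoc, Finset.mul_sum])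
      (by intros; simp [mul_add, Finset.sum_add_distrib])
      (by intros; simp [mul_left_comm, Finset.mul_sum])
  have hk : LinearMap.ker f = dualCode Γ := by
    ext x
    rw [LinearMap.mem_ker, LinearMap.ext_iff]
    constructor
    · intro h c hc
      exact h ⟨c, hc⟩
    · intro h c
      exact h c.1 c.2
  have h1 := LinearMap.finrank_range_add_finrank_ker f
  rw [hk] at h1
  have h2 := Submodule.finrank_le (LinearMap.range f)
  have h3 : Module.finrank F (Γ →ₗ[F] F) = Module.finrank F Γ := Subspace.dual_finrank_eq
  simp at h1
  omega

theorem finrank_inf_supportedOn {F : Type*} [Field F] {n : ℕ}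
    (Γ : Submodule F (Fin n → F)) (d : ℕ) (hd : d + 1 = minDist Γ)
    (hk : Module.finrank F Γ + d = n) (S : Finset (Fin n)) :
    Module.finrank F (Γ ⊓ supportedOn F S : Submodule F (Fin n → F)) = S.card - d := by
  rcases lt_or_ge S.card d with h | h
  · rw [inf_supportedOn_eq_bot Γ S (by omega), finrank_bot]
    omega
  · obtain ⟨T, hTS, hT⟩ := Finset.exists_subset_card_eq h
    have h1 := Submodule.finrank_sup_add_finrank_inf_eq Γ (supportedOn F S)
    have h2 := Submodule.finrank_le (Γ ⊔ supportedOn F S)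
    rw [finrank_supportedOn'] at h1
    simp at h2
    have h3 := Submodule.finrank_sup_add_finrank_inf_eq (Γ ⊓ supportedOn F S) (supportedOn F T)
    have hTS' : supportedOn F T ≤ supportedOn F S := fun x hx i hi => hx i (fun h => hi (hTS h))
    rw [inf_assoc, inf_eq_right.2 hTS', inf_supportedOn_eq_bot Γ T (by omega),
      finrank_supportedOn', finrank_bot, hT] at h3
    have h4 := Submodule.finrank_mono (sup_le (inf_le_right : Γ ⊓ supportedOn F S ≤ _) hTS')
    rw [finrank_supportedOn'] at h4
    omega

theorem card_supersets (n m : ℕ) (hm : m ≤ n) (s : Finset (Fin n)) :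
    ((Finset.powersetCard m (Finset.univ : Finset (Fin n))).filter (fun S => s ⊆ S)).card =
      (n - s.card).choose (n - m) := by
  have h : (n - s.card).choose (n - m) = (Finset.powersetCard (n - m) sᶜ).card := by
    simp [Finset.card_compl]
  rw [h]
  refine Finset.card_bij' (fun S _ => Sᶜ) (fun S _ => Sᶜ) ?_ ?_ (by simp) (by simp)
  · intro S hS
    simp only [Finset.mem_filter, Finset.mem_powersetCard] at hS
    simp [Finset.mem_powersetCard, Finset.card_compl, hS.2, hS.1.2]
  · intro S hS
    rw [Finset.mem_powersetCard] at hS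
    simp only [Finset.mem_filter, Finset.mem_powersetCard, Finset.card_compl, Fintype.card_fin]
    refine ⟨⟨Finset.subset_univ _, by omega⟩, ?_⟩
    rw [Finset.subset_compl_comm]
    exact hS.1

theorem count_identity {F : Type*} [Field F] [Fintype F] {n : ℕ}
    (Γ : Submodule F (Fin n → F)) (d : ℕ) (hd : d + 1 = minDist Γ)
    (hk : Module.finrank F Γ + d = n) (m : ℕ) (hm : m ≤ n) :
    ∑ j ∈ Finset.range (n + 1), wtCount Γ j * (n - j).choose (n - m) =
      n.choose m * (Fintype.card F) ^ (m - d) := by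
  classical
  let G : Finset (Fin n → F) := Finset.univ.filter (fun x => x ∈ Γ)
  let supp : (Fin n → F) → Finset (Fin n) := fun x => Finset.univ.filter (fun i => x i ≠ 0)
  have hwt : ∀ x : Fin n → F, wt x = (supp x).card := by
    intro x
    rw [wt, ← Set.ncard_coe_finset]
    simp [supp]
  have hcnt : ∀ j, wtCount Γ j = (G.filter (fun x => wt x = j)).card := by
    intro j
    rw [wtCount, ← Set.ncard_coe_finset]
    simp [G]
  have hS : ∀ S : Finset (Fin n), (G.filter (fun x => supp x ⊆ S)).card
      = (Fintype.card F) ^ (S.card - d) := by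
    intro S
    rw [← finrank_inf_supportedOn Γ d hd hk S, ← Nat.card_eq_fintype_card (α := F),
      ← Module.natCard_eq_pow_finrank]
    rw [← Set.ncard_coe_finset, ← Nat.card_coe_set_eq]
    apply Nat.card_congr
    apply Equiv.subtypeEquivRight
    intro x
    simp only [G, supp, Finset.coe_filter, Finset.mem_filter, Finset.mem_univ, true_and,
      Set.mem_setOf_eq, Submodule.mem_inf]
    apply and_congr_right
    intro _
    constructor
    · intro h i hi
      by_contra h0
      exact hi (h (by simpa using h0))
    · intro h i hi
      by_contra h0
      simp only [Finset.mem_filter, Finset.mem_univ, true_and] at hi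
      exact hi (h i h0)
  have h1 : ∑ S ∈ Finset.powersetCard m (Finset.univ : Finset (Fin n)),
      (G.filter (fun x => supp x ⊆ S)).card = n.choose m * (Fintype.card F) ^ (m - d) := by
    rw [Finset.sum_congr rfl (g := fun _ => (Fintype.card F) ^ (m - d))]
    · simp
    · intro S hSm
      rw [hS, (Finset.mem_powersetCard.1 hSm).2]
  rw [← h1]
  simp_rw [hcnt]
  have h2 : ∑ S ∈ Finset.powersetCard m (Finset.univ : Finset (Fin n)),
      (G.filter (fun x => supp x ⊆ S)).card = ∑ x ∈ G, (n - wt x).choose (n - m) := by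
    simp_rw [Finset.card_filter]
    rw [Finset.sum_comm]
    apply Finset.sum_congr rfl
    intro x _
    rw [hwt, ← card_supersets n m hm, Finset.card_filter]
  rw [h2]
  rw [← Finset.sum_fiberwise_of_maps_to (s := G) (t := Finset.range (n + 1)) (g := fun x => wt x)]
  · apply Finset.sum_congr rfl
    intro j _
    rw [Finset.sum_congr rfl (g := fun _ => (n - j).choose (n - m))]
    · simp
    · intro x hx
      rw [(Finset.mem_filter.1 hx).2]
  · intro x _
    have := Finset.card_le_univ (supp x)
    simp at this
    simp [hwt]
    omega

theorem avg_identity {F : Type*} [Field F] [Fintype F] {n : ℕ}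
    (Γ : Submodule F (Fin n → F)) (d : ℕ) (hd : d + 1 = minDist Γ)
    (hk : Module.finrank F Γ + d = n) (m : ℕ) (hm : m ≤ n) :
    ∑ j ∈ Finset.range (m + 1), (m.choose j : ℚ) * ((wtCount Γ j : ℚ) / (n.choose j)) =
      (Fintype.card F : ℚ) ^ (m - d) := by
  have h := count_identity Γ d hd hk m hm
  have hnm : (n.choose m : ℚ) ≠ 0 := by
    exact_mod_cast (Nat.choose_pos hm).ne'
  apply mul_left_cancel₀ hnm
  have h' : (n.choose m : ℚ) * (Fintype.card F : ℚ) ^ (m - d) =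
    ∑ j ∈ Finset.range (n + 1), (wtCount Γ j : ℚ) * ((n - j).choose (n - m) : ℕ) := by
    exact_mod_cast h.symm
  rw [h', Finset.mul_sum]
  have hsub : Finset.range (m + 1) ⊆ Finset.range (n + 1) :=
    Finset.range_subset_range.2 (by omega)
  rw [← Finset.sum_subset hsub]
  · apply Finset.sum_congr rfl
    intro j hj
    have hj' : j ≤ m := by simpa [Nat.lt_succ_iff] using hj
    have hc : (n.choose j : ℚ) ≠ 0 := by
      exact_mod_cast (Nat.choose_pos (hj'.trans hm)).ne'
    have h3 : (n.choose m : ℚ) * (m.choose j) = n.choose j * ((n - j).choose (n - m) : ℕ) := by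
      have := Nat.choose_mul (n := n) hj'
      rw [← Nat.choose_symm (n := n - j) (k := m - j) (by omega)] at this
      rw [show n - j - (m - j) = n - m by omega] at this
      exact_mod_cast this
    rw [← mul_assoc, h3]
    field_simp
  · intro j hj hj'
    simp at hj hj'
    rw [Nat.choose_eq_zero_of_lt (by omega)]
    simp

theorem alt_sum (q : ℚ) (v e : ℕ) :
    ∑ k ∈ Finset.range (v + 1), ((-1 : ℤ) ^ (v - k) * v.choose k) •
      (if k ≤ e then 1 - q else 0) =
    (1 - q) * (-1) ^ v * ∑ k ∈ Finset.range (e + 1), ((-1 : ℚ) ^ k * v.choose k) := by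
  have h1 : ∑ k ∈ Finset.range (e + 1), ((-1 : ℚ) ^ k * v.choose k) =
      ∑ k ∈ (Finset.range (v + 1)).filter (fun k => k ≤ e), ((-1 : ℚ) ^ k * v.choose k) := by
    symm
    apply Finset.sum_subset
    · intro k hk
      simp at hk ⊢
      omega
    · intro k hk hk'
      simp at hk hk'
      rw [Nat.choose_eq_zero_of_lt (by by_contra h; have := hk' (by omega); omega)]
      simp
  rw [h1, Finset.sum_filter, Finset.mul_sum]
  apply Finset.sum_congr rfl
  intro k hk
  have hk' : k ≤ v := by simpa [Nat.lt_succ_iff] using hk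
  split_ifs
  · obtain ⟨t, rfl⟩ := Nat.exists_eq_add_of_le hk'
    have : ((-1 : ℚ) ^ k) * (-1) ^ k = 1 := by
      rw [← mul_pow]; simp
    simp only [Nat.add_sub_cancel_left, zsmul_eq_mul]
    push_cast
    rw [pow_add]
    linear_combination (-1 : ℚ) ^ t * ((k + t).choose k) * (1 - q) * (-this)
  · simp

theorem genBinom_nat (n m : ℕ) : genBinom (n : ℚ) m = n.choose m := by
  rw [genBinom, descPochhammer_eval_eq_descFactorial, Nat.choose_eq_descFactorial_div_factorial,
    Nat.cast_div (Nat.factorial_dvd_descFactorial n m)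
      (by exact_mod_cast Nat.factorial_ne_zero m)]

theorem genBinom_neg_one (m : ℕ) : genBinom (-1 : ℚ) m = (-1) ^ m := by
  have h := ascPochhammer_eval_neg_eq_descPochhammer ℚ (-1 : ℚ) m
  rw [neg_neg, ascPochhammer_eval_one] at h
  have h2 : ((-1 : ℚ) ^ m) * (-1) ^ m = 1 := by
    rw [← mul_pow]; simp
  have h3 : (m.factorial : ℚ) ≠ 0 := by exact_mod_cast Nat.factorial_ne_zero m
  rw [genBinom, div_eq_iff h3]
  linear_combination (-(-1 : ℚ) ^ m) * h - (eval (-1) (descPochhammer ℚ m)) * h2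

theorem alt_sum_eval (v e : ℕ) :
    ∑ k ∈ Finset.range (e + 1), ((-1 : ℚ) ^ k * v.choose k) =
      (-1) ^ e * genBinom ((v : ℚ) - 1) e := by
  cases v with
  | zero =>
    have h2 : ((-1 : ℚ) ^ e) * (-1) ^ e = 1 := by
      rw [← mul_pow]; simp
    rw [Finset.sum_range_succ']
    simp [genBinom_neg_one, h2]
  | succ v =>
    rw [show (((v + 1 : ℕ) : ℚ) - 1) = v by push_cast; ring, genBinom_nat]
    exact_mod_cast Int.alternating_sum_range_choose_eq_choose (n := v) (m := e)

theorem solve (n e : ℕ) (q : ℚ) (a : ℕ → ℚ)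
    (h : ∀ m ≤ n, ∑ j ∈ Finset.range (m + 1), (m.choose j : ℚ) * a j = q ^ (m - (e + 1)))
    (v : ℕ) (hv : v + 1 ≤ n) :
    a (v + 1) - (q - 1) * a v = (1 - q) * (-1) ^ v * ((-1) ^ e * genBinom ((v : ℚ) - 1) e) := by
  let N : ℕ → ℚ := fun m => q ^ (m - (e + 1))
  have key : ∀ j ≤ n, a j = (fwdDiff 1)^[j] N 0 := by
    intro j
    induction j using Nat.strong_induction_on with
    | _ j ih =>
      intro hj
      have h1 := h j hj
      have h2 := shift_eq_sum_fwdDiff_iter 1 N j 0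
      rw [Finset.sum_range_succ] at h1 h2
      have h3 : ∑ k ∈ Finset.range j, (j.choose k : ℚ) * a k =
          ∑ k ∈ Finset.range j, j.choose k • (fwdDiff 1)^[k] N 0 := by
        apply Finset.sum_congr rfl
        intro k hk
        have hk' := Finset.mem_range.1 hk
        rw [ih k hk' (by omega), nsmul_eq_mul]
      rw [h3] at h1
      simp only [Nat.choose_self, Nat.cast_one, one_mul, one_smul, smul_eq_mul, mul_one,
        zero_add] at h1 h2
      have h4 : N j = q ^ (j - (e + 1)) := rfl
      linarith
  rw [key _ hv, key v (by omega), ← alt_sum_eval, ← alt_sum]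
  have hN : fwdDiff 1 N = (fun k => if k ≤ e then 1 - q else 0) + (q - 1) • N := by
    ext m
    simp only [fwdDiff, N, Pi.add_apply, Pi.smul_apply, smul_eq_mul]
    split_ifs with hm
    · rw [show m + 1 - (e + 1) = 0 by omega, show m - (e + 1) = 0 by omega]
      ring
    · rw [show m + 1 - (e + 1) = (m - (e + 1)) + 1 by omega]
      ring
  rw [Function.iterate_succ_apply, hN, fwdDiff_iter_add, fwdDiff_iter_const_smul]
  rw [Pi.add_apply, fwdDiff_iter_eq_sum_shift]
  simp

/-- When `d + d⊥ = n + 2`, the signed normalized differences are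
given by generalized binomial coefficients. -/
theorem stmt_4 {F : Type*} [Field F] [Fintype F] {n : ℕ}
    (Γ : Submodule F (Fin n → F))
    (hk0 : 0 < Module.finrank F Γ) (hkn : Module.finrank F Γ < n)
    (q d d' : ℕ) (hq : q = Fintype.card F)
    (hd : d = minDist Γ) (hd' : d' = minDist (dualCode Γ)) (hd2 : 2 ≤ d)
    (a : ℕ → ℚ) (ha : ∀ w, a w = (wtCount Γ w : ℚ) / (n.choose w))
    (hdd : d + d' = n + 2) :
    ∀ w : ℕ, 1 ≤ w → w ≤ n →
      a w - ((q : ℚ) - 1) * a (w - 1) =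
        (-1 : ℚ) ^ ((w : ℤ) - (d : ℤ)) * ((q : ℚ) - 1) * genBinom ((w : ℚ) - 2) (d - 2) := by
  have hdn : minDist Γ ≤ n := minDist_le_card Γ hk0
  have hb1 := singleton_bound Γ (d - 1) (by omega) (by omega)
  have hb2 := singleton_bound (dualCode Γ) (d' - 1) (by omega) (by omega)
  have hb3 := finrank_dualCode_ge Γ
  intro w hw hwn
  obtain ⟨e, rfl⟩ := Nat.exists_eq_add_of_le hd2
  obtain ⟨v, rfl⟩ := Nat.exists_eq_add_of_le hw
  have hs := solve n e q a (fun m hm => by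
    simp_rw [ha]
    rw [avg_identity Γ (e + 1) (by omega) (by omega) m hm, hq]) v (by omega)
  rw [show 1 + v - 1 = v by omega, show 1 + v = v + 1 by omega, hs]
  rw [show 2 + e - 2 = e by omega]
  have hz : (-1 : ℚ) ^ (((v + 1 : ℕ) : ℤ) - ((2 + e : ℕ) : ℤ)) = - ((-1) ^ v * (-1) ^ e) := by
    rw [zpow_sub₀ (by norm_num), zpow_natCast, zpow_natCast]
    have h2 : ((-1 : ℚ) ^ e) * (-1) ^ e = 1 := by
      rw [← mul_pow]; simp
    rw [pow_add, pow_add, div_eq_iff (by simp)]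
    linear_combination (-1 : ℚ) ^ v * h2
  rw [hz, show (((v + 1 : ℕ) : ℚ) - 2) = (v : ℚ) - 1 by push_cast; ring]
  ring

end
end

section
/- Let P(T) = p_0 + p_1 T + ⋯ + p_r T^r be the zeta polynomial of C, where r = n + 2 − d − d⊥. Then for every integer w with 1 ≤ w ≤ n one has (a_w − (q−1)·a_{w−1})·(−1)^{w−d} = (q−1)·Σ_{j=0}^{r} (−1)^j p_j · B(w−2, d+j−2), where B(x, m) denotes the generalized binomial coefficient x(x−1)⋯(x−m+1)/m! evaluated at the integer x = w−2. -/
open Finset Polynomial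

noncomputable section

variable {F : Type*} [Field F] [Fintype F] {ι : Type*} [Fintype ι]

lemma aux_card (Γ : Submodule F (ι → F)) [DecidableEq ι] [DecidableEq F] (R : Finset ι)
    (hR : R.card < minDist (dualCode Γ)) [Fintype Γ] :
    (univ.filter fun c : Γ => ∀ i ∈ R, c.1 i = 0).card * Fintype.card F ^ R.card
      = Fintype.card F ^ Module.finrank F Γ := by
  classical
  let f : Γ →ₗ[F] (R → F) :=
    (LinearMap.funLeft F F (Subtype.val : R → ι)).comp Γ.subtype
  have hf : ∀ (c : Γ) (i : R), f c i = c.1 i := fun c i => rfl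
  have hsurj : LinearMap.range f = ⊤ := by
    by_contra hne
    obtain ⟨g, hg0, hg⟩ := Submodule.exists_le_ker_of_lt_top _ (lt_top_iff_ne_top.2 hne)
    let x : ι → F := fun i => if h : i ∈ R then g (Pi.single ⟨i, h⟩ 1) else 0
    have hgx : ∀ y : R → F, g y = ∑ i : R, x i * y i := by
      intro y
      conv_lhs => rw [← Finset.univ_sum_single y]
      rw [map_sum]
      refine Finset.sum_congr rfl fun i _ => ?_
      have : (Pi.single i (y i) : R → F) = y i • Pi.single i 1 := by
        rw [← Pi.single_smul]; simp
      rw [this, map_smul, smul_eq_mul, mul_comm]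
      simp [x]
    have hx0 : x ≠ 0 := by
      intro h
      apply hg0
      apply LinearMap.ext
      intro y
      rw [hgx]
      simp [h]
    have hxd : x ∈ dualCode Γ := by
      intro c hc
      have h1 : g (f ⟨c, hc⟩) = 0 := hg ⟨_, rfl⟩
      rw [hgx] at h1
      rw [← h1]
      have : ∑ i, x i * c i = ∑ i ∈ R, x i * c i := by
        symm
        apply Finset.sum_subset (Finset.subset_univ _)
        intro i _ hi
        simp [x, hi]
      rw [this, ← Finset.sum_coe_sort]
      rfl
    have hw : wt x ≤ R.card := by
      unfold wt
      rw [← Set.ncard_coe_finset R]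
      apply Set.ncard_le_ncard _ (Finset.finite_toSet _)
      intro i hi
      by_contra h
      apply hi
      have : i ∉ R := h
      simp [x, this]
    have : minDist (dualCode Γ) ≤ wt x := Nat.sInf_le ⟨x, hxd, hx0, rfl⟩
    omega
  have h1 := LinearMap.finrank_range_add_finrank_ker f
  rw [hsurj, finrank_top, Module.finrank_fintype_fun_eq_card, Fintype.card_coe] at h1
  have h2 : (univ.filter fun c : Γ => ∀ i ∈ R, c.1 i = 0).card
      = Fintype.card F ^ Module.finrank F (LinearMap.ker f) := by
    rw [← Module.card_eq_pow_finrank (K := F) (V := LinearMap.ker f), ← Fintype.card_subtype]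
    apply Fintype.card_congr
    refine Equiv.subtypeEquivRight fun c => ?_
    rw [LinearMap.mem_ker]
    constructor
    · intro h; ext i; exact h i i.2
    · intro h i hi; exact congrFun h ⟨i, hi⟩
  rw [h2, ← pow_add, add_comm, h1]

lemma aux_N {n : ℕ} (Γ : Submodule F (Fin n → F)) (a : ℕ → ℚ)
    (ha : ∀ w, a w = (wtCount Γ w : ℚ) / (n.choose w)) (m : ℕ) (hm : m ≤ n)
    (hm' : n - m < minDist (dualCode Γ)) :
    (∑ w ∈ range (n + 1), a w * (m.choose w : ℚ)) * (Fintype.card F : ℚ) ^ (n - m)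
      = (Fintype.card F : ℚ) ^ Module.finrank F Γ := by
  classical
  have : Fintype Γ := Fintype.ofFinite _
  have hwt : ∀ x : Fin n → F, (univ.filter fun i => x i = 0).card = n - wt x := by
    intro x
    have h1 : wt x = (univ.filter fun i => ¬ x i = 0).card := by
      unfold wt
      rw [← Set.ncard_coe_finset]; simp
    have h2 := Finset.card_filter_add_card_filter_not (s := (univ : Finset (Fin n))) (fun i => x i = 0)
    rw [Finset.card_univ, Fintype.card_fin] at h2
    omega
  have hwle : ∀ x : Fin n → F, wt x ≤ n := by
    intro x
    unfold wt
    refine (Set.ncard_le_card _).trans ?_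
    simp
  have hA : ∀ w, wtCount Γ w = (univ.filter fun c : Γ => wt c.1 = w).card := by
    intro w
    unfold wtCount
    rw [← Fintype.card_subtype, ← Nat.card_coe_set_eq, ← Nat.card_eq_fintype_card]
    exact Nat.card_congr (Equiv.subtypeSubtypeEquivSubtypeInter (fun x => x ∈ Γ) (fun x => wt x = w)).symm
  have hdc : ∑ R ∈ powersetCard (n - m) (univ : Finset (Fin n)),
      (univ.filter fun c : Γ => ∀ i ∈ R, c.1 i = 0).card
      = ∑ c : Γ, (n - wt c.1).choose (n - m) := by
    simp_rw [Finset.card_filter]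
    rw [Finset.sum_comm]
    refine Finset.sum_congr rfl fun c _ => ?_
    rw [← Finset.card_filter, ← hwt, ← Finset.card_powersetCard]
    congr 1
    ext R
    simp only [mem_filter, mem_powersetCard, true_and, Finset.subset_iff, mem_univ]
    tauto
  have hsum : ∑ c : Γ, (n - wt c.1).choose (n - m)
      = ∑ w ∈ range (n + 1), wtCount Γ w * (n - w).choose (n - m) := by
    rw [← Finset.sum_fiberwise_of_maps_to (s := univ) (t := range (n+1)) (g := fun c : Γ => wt c.1)
      (fun c _ => by simpa using Nat.lt_succ_of_le (hwle c.1))]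
    refine Finset.sum_congr rfl fun w _ => ?_
    rw [hA, ← smul_eq_mul, ← Finset.sum_const]
    refine Finset.sum_congr rfl fun c hc => ?_
    rw [(mem_filter.1 hc).2]
  have hL : (∑ R ∈ powersetCard (n - m) (univ : Finset (Fin n)),
      (univ.filter fun c : Γ => ∀ i ∈ R, c.1 i = 0).card) * Fintype.card F ^ (n - m)
      = n.choose (n - m) * Fintype.card F ^ Module.finrank F Γ := by
    rw [Finset.sum_mul]
    rw [Finset.sum_congr rfl (g := fun _ => Fintype.card F ^ Module.finrank F Γ)]
    · simp
    · intro R hR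
      have hc := (mem_powersetCard.1 hR).2
      rw [← hc]
      convert aux_card Γ R (by omega)
  rw [hdc, hsum] at hL
  have hLq : (∑ w ∈ range (n + 1), (wtCount Γ w : ℚ) * ((n - w).choose (n - m) : ℚ))
      * (Fintype.card F : ℚ) ^ (n - m)
      = (n.choose (n - m) : ℚ) * (Fintype.card F : ℚ) ^ Module.finrank F Γ := by
    exact_mod_cast hL
  have hpos : (n.choose (n - m) : ℚ) ≠ 0 := by
    have := Nat.choose_pos (Nat.sub_le n m)
    positivity
  apply mul_left_cancel₀ hpos
  rw [← hLq, ← mul_assoc, Finset.mul_sum]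
  congr 1
  refine Finset.sum_congr rfl fun w hw => ?_
  have hw' : w ≤ n := by simpa [Nat.lt_succ_iff] using hw
  have hpw : (n.choose w : ℚ) ≠ 0 := by
    have := Nat.choose_pos hw'
    positivity
  have key : n.choose w * (n - w).choose (n - m) = n.choose (n - m) * m.choose w := by
    by_cases h : w ≤ m
    · rw [Nat.choose_symm hm, Nat.choose_mul h]
      congr 1
      rw [← Nat.choose_symm (by omega : n - m ≤ n - w)]
      congr 1
      omega
    · rw [Nat.choose_eq_zero_of_lt (by omega : m < w), Nat.choose_eq_zero_of_lt (by omega : n - w < n - m)]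
      simp
  have keyq : (n.choose w : ℚ) * ((n - w).choose (n - m) : ℚ) = n.choose (n - m) * m.choose w := by
    exact_mod_cast key
  rw [ha]
  field_simp
  linear_combination (-(wtCount Γ w : ℚ)) * keyq

lemma aux_genBinom_nat (v m : ℕ) : genBinom (v : ℚ) m = v.choose m := by
  unfold genBinom
  rw [descPochhammer_eval_eq_descFactorial, Nat.descFactorial_eq_factorial_mul_choose]
  have : (m.factorial : ℚ) ≠ 0 := by exact_mod_cast m.factorial_ne_zero
  push_cast
  field_simp

lemma aux_genBinom_neg (m : ℕ) : genBinom (-1) m = (-1) ^ m := by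
  unfold genBinom
  have : (m.factorial : ℚ) ≠ 0 := by exact_mod_cast m.factorial_ne_zero
  rw [div_eq_iff this]
  clear this
  induction m with
  | zero => simp
  | succ k ih =>
    rw [descPochhammer_succ_eval, ih, Nat.factorial_succ]
    push_cast
    ring

/-- shifted binomial transform -/
def auxD (n : ℕ) (b : ℕ → ℚ) (s m : ℕ) : ℚ := ∑ w ∈ range (n + 1), b (w + s) * (m.choose w : ℚ)

lemma auxD_succ (n : ℕ) (b : ℕ → ℚ) (hb : ∀ w, n < w → b w = 0) (s m : ℕ) :
    auxD n b s (m + 1) = auxD n b s m + auxD n b (s + 1) m := by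
  unfold auxD
  rw [Finset.sum_range_succ' _ n, Finset.sum_range_succ' _ n, Finset.sum_range_succ _ n]
  rw [hb (n + (s + 1)) (by omega)]
  have : ∀ k, b (k + 1 + s) * ((m + 1).choose (k + 1) : ℚ)
      = b (k + 1 + s) * (m.choose (k + 1) : ℚ) + b (k + (s + 1)) * (m.choose k : ℚ) := by
    intro k
    rw [Nat.choose_succ_succ, show k + 1 + s = k + (s + 1) by ring]
    push_cast
    ring
  simp_rw [this, Finset.sum_add_distrib]
  simp
  ring

lemma auxD_zero (n : ℕ) (b : ℕ → ℚ) (s : ℕ) : auxD n b s 0 = b s := by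
  unfold auxD
  rw [Finset.sum_range_succ']
  simp

open fwdDiff in
lemma auxD_iter (n : ℕ) (b : ℕ → ℚ) (hb : ∀ w, n < w → b w = 0) (s v : ℕ) :
    (fwdDiff 1)^[v] (auxD n b s) = auxD n b (s + v) := by
  induction v with
  | zero => rfl
  | succ v ih =>
    rw [Function.iterate_succ_apply', ih]
    funext m
    rw [fwdDiff, auxD_succ n b hb]
    rw [add_sub_cancel_left, add_assoc]

lemma auxD_alt (n : ℕ) (b : ℕ → ℚ) (hb : ∀ w, n < w → b w = 0) (s v y : ℕ) :
    ∑ i ∈ range (v + 1), (-1 : ℚ) ^ i * (v.choose i : ℚ) * auxD n b s (y + i)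
      = (-1) ^ v * auxD n b (s + v) y := by
  rw [← auxD_iter n b hb, fwdDiff_iter_eq_sum_shift, Finset.mul_sum]
  refine Finset.sum_congr rfl fun i hi => ?_
  have hi' : i ≤ v := by simpa [Nat.lt_succ_iff] using hi
  obtain ⟨t, rfl⟩ := Nat.exists_eq_add_of_le hi'
  simp only [add_tsub_cancel_left, smul_eq_mul, mul_one, zsmul_eq_mul]
  push_cast
  have : (-1 : ℚ) ^ t * (-1) ^ t = 1 := by rw [← mul_pow]; simp
  rw [pow_add]
  linear_combination (-(-1 : ℚ) ^ i * ((i + t).choose i : ℚ) * auxD n b s (y + i)) * this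

lemma aux_K (q n e : ℕ) (hen : e + 2 ≤ n) (a : ℕ → ℚ) (P : ℚ[X]) (hq1 : (q : ℚ) - 1 ≠ 0)
    (h : zetaCongr q n (e + 2) a P) (M : ℕ → ℚ)
    (hM : ∀ m, M m = ∑ w ∈ Icc (e + 2) n, a w * (m.choose w : ℚ)) (i : ℕ) (hi : i + 2 ≤ n) :
    ((q : ℚ) - 1) * (X ^ e * P).coeff i = M (i + 2) - (q + 1) * M (i + 1) + q * M i := by
  obtain ⟨Q, hQ⟩ := h
  have hQ' := congrArg (fun p : ℚ[X] => (p : PowerSeries ℚ)) hQ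
  let I : PowerSeries ℚ := PowerSeries.mk 1
  have hI : (1 - PowerSeries.X) * I = 1 := by
    rw [mul_comm]; exact PowerSeries.mk_one_mul_one_sub_eq_one ℚ
  have hIp : ∀ k : ℕ, (1 - PowerSeries.X) ^ k * I ^ k = 1 := by
    intro k; rw [← mul_pow, hI, one_pow]
  have hMs : PowerSeries.mk M
      = ∑ w ∈ Icc (e + 2) n, PowerSeries.C (a w) * (PowerSeries.X ^ w * I ^ (w + 1)) := by
    ext m
    rw [PowerSeries.coeff_mk, hM, map_sum]
    refine Finset.sum_congr rfl fun w _ => ?_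
    rw [PowerSeries.coeff_C_mul, PowerSeries.mk_one_pow_eq_mk_choose_add,
      PowerSeries.coeff_X_pow_mul']
    split_ifs with hwm
    · rw [PowerSeries.coeff_mk, Nat.add_sub_cancel' hwm]
    · rw [Nat.choose_eq_zero_of_lt (by omega)]; simp
  have hcoe : ∀ s : Finset ℕ, ∀ g : ℕ → ℚ[X],
      ((∑ w ∈ s, g w : ℚ[X]) : PowerSeries ℚ) = ∑ w ∈ s, (g w : PowerSeries ℚ) := by
    intro s g
    exact map_sum (Polynomial.coeToPowerSeries.ringHom (R := ℚ)) g s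
  simp only [Polynomial.coe_sub, Polynomial.coe_mul, Polynomial.coe_pow, Polynomial.coe_X,
    Polynomial.coe_C, Polynomial.coe_one, hcoe] at hQ'
  have hS : PowerSeries.X ^ (e + 2) * I ^ n * (∑ w ∈ Icc (e + 2) n, PowerSeries.C (a w)
      * PowerSeries.X ^ (w - (e + 2)) * (1 - PowerSeries.X) ^ (n - w))
      = (1 - PowerSeries.X) * PowerSeries.mk M := by
    rw [hMs, Finset.mul_sum, Finset.mul_sum]
    refine Finset.sum_congr rfl fun w hw => ?_
    obtain ⟨hw1, hw2⟩ := mem_Icc.1 hw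
    obtain ⟨t, rfl⟩ := Nat.exists_eq_add_of_le hw1
    obtain ⟨u, rfl⟩ := Nat.exists_eq_add_of_le hw2
    rw [add_tsub_cancel_left, add_tsub_cancel_left]
    have h1 := hIp u
    linear_combination (PowerSeries.C (a (e + 2 + t)) * PowerSeries.X ^ (e + 2 + t)
      * I ^ (e + 2 + t)) * (h1 - hI)
  have hfin : PowerSeries.C ((q : ℚ) - 1) * (PowerSeries.X * (PowerSeries.X *
        ((X ^ e * P : ℚ[X]) : PowerSeries ℚ)))
      = PowerSeries.mk M - PowerSeries.C ((q : ℚ) + 1) * (PowerSeries.X * PowerSeries.mk M)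
        + PowerSeries.C (q : ℚ) * (PowerSeries.X * (PowerSeries.X * PowerSeries.mk M))
        + PowerSeries.X ^ (n + 1) * (PowerSeries.C ((q : ℚ) - 1) * I ^ n * (Q : PowerSeries ℚ)) := by
    have hX : (PowerSeries.X : PowerSeries ℚ) ^ (n + 1)
        = PowerSeries.X ^ (e + 2) * PowerSeries.X ^ (n - (e + 2) + 1) := by
      rw [← pow_add]; congr 1; omega
    have hC : PowerSeries.C ((q : ℚ) - 1) * PowerSeries.C (((q : ℚ) - 1)⁻¹) = 1 := by
      rw [← map_mul, mul_inv_cancel₀ hq1, map_one]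
    have hCa : PowerSeries.C ((q : ℚ) + 1) = PowerSeries.C (q : ℚ) + 1 := by
      rw [map_add, map_one]
    rw [hX, hCa, Polynomial.coe_mul, Polynomial.coe_pow, Polynomial.coe_X]
    have h1 := hIp n
    linear_combination (PowerSeries.C ((q : ℚ) - 1) * PowerSeries.X ^ (e + 2) * I ^ n) * hQ'
      - (PowerSeries.C ((q : ℚ) - 1) * PowerSeries.X ^ (e + 2) * (P : PowerSeries ℚ)) * h1
      + (PowerSeries.C ((q : ℚ) - 1) * PowerSeries.C (((q : ℚ) - 1)⁻¹)
        * (1 - PowerSeries.C (q : ℚ) * PowerSeries.X)) * hS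
      + ((1 - PowerSeries.C (q : ℚ) * PowerSeries.X) * (1 - PowerSeries.X) * PowerSeries.mk M) * hC
  clear hQ hQ' hS
  generalize (q : ℚ) - 1 = c₁ at hfin ⊢
  generalize (q : ℚ) + 1 = c₂ at hfin ⊢
  have hc := congrArg (PowerSeries.coeff (i + 2)) hfin
  simp only [map_add, map_sub, PowerSeries.coeff_C_mul] at hc
  rw [PowerSeries.coeff_X_pow_mul', if_neg (by omega)] at hc
  rw [show i + 2 = (i + 1) + 1 from rfl] at hc
  simp only [PowerSeries.coeff_succ_X_mul, PowerSeries.coeff_mk, Polynomial.coeff_coe] at hc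
  rw [hc, add_zero]

/-- expression of the signed normalized differences in terms of
the coefficients of the zeta polynomial. -/
theorem stmt_5 {F : Type*} [Field F] [Fintype F] {n : ℕ}
    (Γ : Submodule F (Fin n → F))
    (hk0 : 0 < Module.finrank F Γ) (hkn : Module.finrank F Γ < n)
    (q d d' : ℕ) (hq : q = Fintype.card F)
    (hd : d = minDist Γ) (hd' : d' = minDist (dualCode Γ))
    (hd2 : 2 ≤ d) (hd'2 : 2 ≤ d')
    (a : ℕ → ℚ) (ha : ∀ w, a w = (wtCount Γ w : ℚ) / (n.choose w))
    (P : ℚ[X]) (hP : IsZetaPoly q n d a P)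
    (r : ℕ) (hr : r = n + 2 - d - d') :
    ∀ w : ℕ, 1 ≤ w → w ≤ n →
      (a w - ((q : ℚ) - 1) * a (w - 1)) * (-1 : ℚ) ^ ((w : ℤ) - (d : ℤ)) =
        ((q : ℚ) - 1) *
          ∑ j ∈ Finset.range (r + 1),
            (-1 : ℚ) ^ j * P.coeff j * genBinom ((w : ℚ) - 2) (d + j - 2) := by
  intro w hw1 hwn
  obtain ⟨e, rfl⟩ : ∃ e, d = e + 2 := ⟨d - 2, by omega⟩
  have hq2 : (1 : ℚ) < q := by
    rw [hq]; exact_mod_cast Fintype.one_lt_card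
  have hq1 : (q : ℚ) - 1 ≠ 0 := by linarith
  have hwle : ∀ x : Fin n → F, wt x ≤ n := by
    intro x
    unfold wt
    refine (Set.ncard_le_card _).trans ?_
    simp
  have hdn : e + 2 ≤ n := by
    have hne : {w | ∃ x ∈ Γ, x ≠ 0 ∧ wt x = w}.Nonempty := by
      by_contra hcon
      rw [Set.not_nonempty_iff_eq_empty] at hcon
      unfold minDist at hd
      rw [hcon, Nat.sInf_empty] at hd
      omega
    obtain ⟨x, _, _, hx⟩ := Nat.sInf_mem hne
    have h1 := hwle x
    unfold minDist at hd
    omega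
  have hsmall : ∀ w, 1 ≤ w → w < e + 2 → a w = 0 := by
    intro w h1 h2
    have : wtCount Γ w = 0 := by
      unfold wtCount
      rw [Set.ncard_eq_zero (Set.toFinite _)]
      by_contra hcon
      obtain ⟨x, hx, hxw⟩ := Set.nonempty_iff_ne_empty.2 hcon
      have hx0 : x ≠ 0 := by
        rintro rfl
        simp [wt] at hxw
        omega
      have : minDist Γ ≤ w := Nat.sInf_le ⟨x, hx, hx0, hxw⟩
      omega
    rw [ha, this]
    simp
  have hzero : a 0 = 1 := by
    have : wtCount Γ 0 = 1 := by
      unfold wtCount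
      rw [Set.ncard_eq_one]
      refine ⟨0, ?_⟩
      ext x
      simp only [Set.mem_ofPred_eq, Set.mem_singleton_iff]
      constructor
      · rintro ⟨_, hx⟩
        unfold wt at hx
        rw [Set.ncard_eq_zero (Set.toFinite _)] at hx
        funext i
        by_contra hi
        have : i ∈ {i | x i ≠ 0} := hi
        rw [hx] at this
        exact this
      · rintro rfl
        exact ⟨Γ.zero_mem, by simp [wt]⟩
    rw [ha, this]
    simp
  have hbig : ∀ w, n < w → a w = 0 := by
    intro w h1
    rw [ha, Nat.choose_eq_zero_of_lt h1]
    simp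
  let b : ℕ → ℚ := fun w => if w = 0 then 0 else a w
  have hb0 : b 0 = 0 := rfl
  have hbpos : ∀ w, 1 ≤ w → b w = a w := fun w hw => if_neg (by omega)
  have hb : ∀ w, n < w → b w = 0 := by
    intro w h1
    rw [hbpos w (by omega), hbig w h1]
  set M : ℕ → ℚ := auxD n b 0 with hMdef
  have hM : ∀ m, M m = ∑ w ∈ Icc (e + 2) n, a w * (m.choose w : ℚ) := by
    intro m
    rw [hMdef]
    unfold auxD
    symm
    have hsub : Icc (e + 2) n ⊆ range (n + 1) := by
      intro w hw
      rw [mem_Icc] at hw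
      rw [mem_range]
      omega
    rw [← Finset.sum_subset hsub]
    · refine Finset.sum_congr rfl fun w hw => ?_
      rw [mem_Icc] at hw
      rw [add_zero, hbpos w (by omega)]
    · intro w hw hw'
      rw [mem_range] at hw
      rw [mem_Icc] at hw'
      rcases Nat.eq_zero_or_pos w with rfl | h0
      · simp [hb0]
      · rw [add_zero, hbpos w h0, hsmall w h0 (by omega), zero_mul]
  have hMN : ∀ m, M m + 1 = ∑ w ∈ range (n + 1), a w * (m.choose w : ℚ) := by
    intro m
    rw [hMdef]
    unfold auxD
    rw [Finset.sum_range_succ', Finset.sum_range_succ' _ n, hzero]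
    simp [hb0]
    refine Finset.sum_congr rfl fun w _ => ?_
    rw [hbpos (w + 1) (by omega)]
  have hrec : ∀ m, m < n → n < m + d' → M (m + 1) + 1 = q * (M m + 1) := by
    intro m hm hmd
    have h1 := aux_N Γ a ha m hm.le (by omega)
    have h2 := aux_N Γ a ha (m + 1) hm (by omega)
    rw [← hMN, ← hq] at h1 h2
    rw [show n - m = (n - (m + 1)) + 1 by omega] at h1
    have hqp : (q : ℚ) ^ (n - (m + 1)) ≠ 0 := pow_ne_zero _ (by linarith)
    apply mul_right_cancel₀ hqp
    rw [h2, ← h1]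
    ring
  have hK := aux_K q n e hdn a P hq1 hP.2 M hM
  have hPbig : ∀ j, r < j → P.coeff j = 0 := by
    intro j hj
    by_cases hjn : n - (e + 2) < j
    · exact Polynomial.coeff_eq_zero_of_natDegree_lt (lt_of_le_of_lt hP.1 hjn)
    · have h1 := hK (e + j) (by omega)
      rw [Polynomial.coeff_X_pow_mul', if_pos (by omega), add_tsub_cancel_left] at h1
      have h2 := hrec (e + j) (by omega) (by omega)
      have h3 := hrec (e + j + 1) (by omega) (by omega)
      have h4 : ((q : ℚ) - 1) * P.coeff j = 0 := by
        rw [h1]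
        linear_combination h3 - h2
      exact (mul_eq_zero.1 h4).resolve_left hq1
  -- the coefficients, shifted
  have hsumgen : ∀ (f : ℕ → ℚ) (L : ℕ), (∀ i, L ≤ i → i < n - 1 → f i = 0) → L ≤ n - 1 →
      ∑ j ∈ range (r + 1), P.coeff j * f (e + j)
        = ∑ i ∈ range L, (X ^ e * P).coeff i * f i := by
    intro f L hf hL
    have h1 : ∑ i ∈ range L, (X ^ e * P).coeff i * f i
        = ∑ i ∈ range (e + (r + 1 + n)), (X ^ e * P).coeff i * f i := by
      apply Finset.sum_subset
      · intro i hi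
        rw [mem_range] at hi ⊢
        omega
      · intro i hi hi'
        rw [mem_range] at hi hi'
        by_cases hin : i < n - 1
        · rw [hf i (by omega) hin, mul_zero]
        · rw [Polynomial.coeff_X_pow_mul', if_pos (by omega),
            Polynomial.coeff_eq_zero_of_natDegree_lt (by have := hP.1; omega), zero_mul]
    rw [h1, Finset.sum_range_add (fun i => (X ^ e * P : ℚ[X]).coeff i * f i) e (r + 1 + n)]
    rw [Finset.sum_eq_zero (s := range e), zero_add]
    · have h2 : ∀ j, (X ^ e * P).coeff (e + j) = P.coeff j := by
        intro j
        rw [Polynomial.coeff_X_pow_mul', if_pos (by omega), add_tsub_cancel_left]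
      simp_rw [h2]
      apply Finset.sum_subset
      · intro i hi
        rw [mem_range] at hi ⊢
        omega
      · intro i _ hi'
        rw [mem_range] at hi'
        rw [hPbig i (by omega), zero_mul]
    · intro i hi
      rw [mem_range] at hi
      rw [Polynomial.coeff_X_pow_mul', if_neg (by omega), zero_mul]
  have hsgn : (-1 : ℚ) ^ ((w : ℤ) - ((e + 2 : ℕ) : ℤ)) = (-1) ^ w * (-1) ^ e := by
    rw [zpow_sub₀ (by norm_num), zpow_natCast, zpow_natCast, pow_add]
    rcases neg_one_pow_eq_or ℚ e with h | h <;> rw [h] <;> simp [div_neg]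
  have hee : (-1 : ℚ) ^ e * (-1) ^ e = 1 := by rw [← mul_pow]; simp
  rw [hsgn]
  have hterm : ∀ j, (-1 : ℚ) ^ j * P.coeff j * genBinom ((w : ℚ) - 2) (e + 2 + j - 2)
      = (-1) ^ e * (P.coeff j * ((-1) ^ (e + j) * genBinom ((w : ℚ) - 2) (e + j))) := by
    intro j
    rw [show e + 2 + j - 2 = e + j by omega, pow_add]
    linear_combination (-(-1 : ℚ) ^ j * P.coeff j * genBinom ((w : ℚ) - 2) (e + j)) * hee
  simp_rw [hterm]
  rw [← Finset.mul_sum]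
  rcases Nat.lt_or_ge w 2 with hw2 | hw2
  · obtain rfl : w = 1 := by omega
    rw [hsumgen (fun i => (-1) ^ i * genBinom (((1 : ℕ) : ℚ) - 2) i) (n - 1)
      (fun i h1 h2 => by omega) le_rfl]
    have h1 : ∀ i, (-1 : ℚ) ^ i * genBinom (((1 : ℕ) : ℚ) - 2) i = 1 := by
      intro i
      rw [show (((1 : ℕ) : ℚ) - 2) = -1 by norm_num, aux_genBinom_neg, ← mul_pow]
      simp
    simp_rw [h1, mul_one]
    have h2 : ((q : ℚ) - 1) * ∑ i ∈ range (n - 1), (X ^ e * P).coeff i = q - 1 := by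
      rw [Finset.mul_sum]
      let g : ℕ → ℚ := fun i => M (i + 1) - q * M i
      have h3 : ∀ i ∈ range (n - 1), ((q : ℚ) - 1) * (X ^ e * P).coeff i
          = g (i + 1) - g i := by
        intro i hi
        rw [mem_range] at hi
        rw [hK i (by omega)]
        simp only [g]
        ring
      rw [Finset.sum_congr rfl h3, Finset.sum_range_sub]
      have hM0 : M 0 = 0 := by
        rw [hMdef, auxD_zero, hb0]
      have hM1 : M 1 = 0 := by
        rw [hMdef, auxD_succ n b hb, auxD_zero, auxD_zero, hb0, hbpos 1 le_rfl,
          hsmall 1 le_rfl (by omega)]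
        simp
      have h4 := hrec (n - 1) (by omega) (by omega)
      rw [show n - 1 + 1 = n by omega] at h4
      simp only [g, show n - 1 + 1 = n by omega, zero_add, hM0, hM1]
      linear_combination h4
    rw [hsmall 1 le_rfl (by omega), hzero]
    linear_combination (-(-1 : ℚ) ^ e) * h2
  · obtain ⟨v, rfl⟩ : ∃ v, w = v + 2 := ⟨w - 2, by omega⟩
    rw [show ((v + 2 : ℕ) : ℚ) - 2 = v by push_cast; ring]
    simp_rw [aux_genBinom_nat]
    rw [hsumgen (fun i => (-1) ^ i * (v.choose i : ℚ)) (v + 1)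
      (fun i h1 h2 => by rw [Nat.choose_eq_zero_of_lt (by omega)]; simp) (by omega)]
    have h1 : ((q : ℚ) - 1) * ∑ i ∈ range (v + 1), (X ^ e * P).coeff i * ((-1) ^ i * (v.choose i : ℚ))
        = (-1) ^ v * (a (v + 2) - (q - 1) * a (v + 1)) := by
      have h2 := auxD_alt n b hb 0 v 0
      have h3 := auxD_alt n b hb 0 v 1
      have h4 := auxD_alt n b hb 0 v 2
      rw [← hMdef] at h2 h3 h4
      have h5 : ((q : ℚ) - 1) * ∑ i ∈ range (v + 1),
            (X ^ e * P).coeff i * ((-1) ^ i * (v.choose i : ℚ))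
          = ∑ i ∈ range (v + 1), (-1 : ℚ) ^ i * (v.choose i : ℚ) * M (2 + i)
            - (q + 1) * ∑ i ∈ range (v + 1), (-1 : ℚ) ^ i * (v.choose i : ℚ) * M (1 + i)
            + q * ∑ i ∈ range (v + 1), (-1 : ℚ) ^ i * (v.choose i : ℚ) * M (0 + i) := by
        rw [Finset.mul_sum, Finset.mul_sum, Finset.mul_sum, ← Finset.sum_sub_distrib,
          ← Finset.sum_add_distrib]
        refine Finset.sum_congr rfl fun i hi => ?_
        rw [mem_range] at hi
        have h6 := hK i (by omega)
        rw [add_comm 2 i, add_comm 1 i, zero_add]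
        linear_combination ((-1 : ℚ) ^ i * (v.choose i : ℚ)) * h6
      rw [h5, h2, h3, h4]
      rw [show (2 : ℕ) = 0 + 1 + 1 from rfl, show (1 : ℕ) = 0 + 1 from rfl]
      simp only [auxD_succ n b hb, auxD_zero]
      rw [hbpos (0 + v + (0 + 1) + (0 + 1)) (by omega), hbpos (0 + v + (0 + 1)) (by omega)]
      simp only [zero_add]
      ring_nf
    rw [show v + 2 - 1 = v + 1 from rfl]
    rw [pow_add]
    linear_combination (-(-1 : ℚ) ^ e) * h1

end
end

section
/- Let P(T) = p_0 + p_1 T + ⋯ be the zeta polynomial of C. Then (q−1)·p_0 = a_d and (q−1)·p_1 = a_{d+1} − (q−d)·a_d; consequently, writing a = p_1/p_0, one has a_d·(a − d + q) = a_{d+1}, and since a_{d+1} ≥ 0 and a_d > 0 it follows that d ≤ q + p_1/p_0. -/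
open Finset Polynomial

noncomputable section

variable {F : Type*} [Field F] [Fintype F] {ι : Type*} [Fintype ι]

/-- the first two coefficients of the zeta polynomial, and the
resulting bound `d ≤ q + p₁/p₀`. -/
theorem stmt_6 {F : Type*} [Field F] [Fintype F] {n : ℕ}
    (Γ : Submodule F (Fin n → F))
    (hk0 : 0 < Module.finrank F Γ) (hkn : Module.finrank F Γ ≤ n)
    (q d : ℕ) (hq : q = Fintype.card F)
    (hd : d = minDist Γ) (hdn : d + 1 ≤ n)
    (a : ℕ → ℚ) (ha : ∀ w, a w = (wtCount Γ w : ℚ) / (n.choose w))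
    (P : ℚ[X]) (hP : IsZetaPoly q n d a P) :
    ((q : ℚ) - 1) * P.coeff 0 = a d ∧
    ((q : ℚ) - 1) * P.coeff 1 = a (d + 1) - ((q : ℚ) - (d : ℚ)) * a d ∧
    a d * (P.coeff 1 / P.coeff 0 - (d : ℚ) + (q : ℚ)) = a (d + 1) ∧
    (d : ℚ) ≤ (q : ℚ) + P.coeff 1 / P.coeff 0 := by
  have hq1 : (1 : ℚ) < q := by
    rw [hq]; exact_mod_cast Fintype.one_lt_card
  have hq0 : (q : ℚ) - 1 ≠ 0 := by linarith
  -- the leading normalized weight is positive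
  have hne : {w | ∃ x ∈ Γ, x ≠ 0 ∧ wt x = w}.Nonempty := by
    have hbot : Γ ≠ ⊥ := by
      rintro rfl
      simp at hk0
    obtain ⟨x, hx, hx0⟩ := Submodule.exists_mem_ne_zero_of_ne_bot hbot
    exact ⟨wt x, x, hx, hx0, rfl⟩
  have hmem := Nat.sInf_mem hne
  obtain ⟨x, hx, hx0, hxw⟩ := hmem
  have hxd : wt x = d := by rw [hd]; exact hxw
  have hcnt : 0 < wtCount Γ d := by
    unfold wtCount
    rw [Set.ncard_pos (Set.toFinite _)]
    exact ⟨x, hx, hxd⟩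
  have had : 0 < a d := by
    rw [ha]
    have h1 : 0 < n.choose d := Nat.choose_pos (by omega)
    positivity
  have had1 : 0 ≤ a (d + 1) := by
    rw [ha]; positivity
  obtain ⟨_, hc⟩ := hP
  unfold zetaCongr at hc
  have hsum : ∃ S : ℚ[X], ∑ w ∈ Finset.Icc d n,
      Polynomial.C (a w) * X ^ (w - d) * (1 - X) ^ (n - w) =
      Polynomial.C (a d) * (1 - X) ^ (n - d) +
      Polynomial.C (a (d + 1)) * X * (1 - X) ^ (n - (d + 1)) + X ^ 2 * S := by
    refine ⟨∑ w ∈ Finset.Icc (d + 2) n,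
      Polynomial.C (a w) * X ^ (w - d - 2) * (1 - X) ^ (n - w), ?_⟩
    rw [← Finset.add_sum_Ioc_eq_sum_Icc (by omega : d ≤ n),
      ← Finset.Icc_add_one_left_eq_Ioc, ← Finset.add_sum_Ioc_eq_sum_Icc hdn,
      ← Finset.Icc_add_one_left_eq_Ioc, Finset.mul_sum]
    have : ∑ w ∈ Finset.Icc (d + 1 + 1) n,
        Polynomial.C (a w) * X ^ (w - d) * (1 - X) ^ (n - w) =
        ∑ w ∈ Finset.Icc (d + 2) n, X ^ 2 *
        (Polynomial.C (a w) * X ^ (w - d - 2) * (1 - X) ^ (n - w)) := by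
      refine Finset.sum_congr rfl fun w hw => ?_
      have hw' := (Finset.mem_Icc.mp hw).1
      obtain ⟨m, rfl⟩ := Nat.exists_eq_add_of_le hw'
      have e1 : d + 1 + 1 + m - d = m + 2 := by omega
      rw [e1, Nat.add_sub_cancel]
      ring
    rw [this]
    simp
    ring
  obtain ⟨S, hS⟩ := hsum
  rw [hS] at hc
  have hc2 := (pow_dvd_pow (X : ℚ[X]) (by omega : 2 ≤ n - d + 1)).trans hc
  obtain ⟨R, hR⟩ := hc2
  have h0 := congrArg (fun p => Polynomial.eval 0 p) hR
  have h1 := congrArg (fun p => Polynomial.eval 0 (Polynomial.derivative p)) hR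
  have hp1 : P.coeff 1 = Polynomial.eval 0 (Polynomial.derivative P) := by
    rw [← Polynomial.coeff_zero_eq_eval_zero, Polynomial.coeff_derivative]; simp
  have hp0 : P.coeff 0 = Polynomial.eval 0 P := Polynomial.coeff_zero_eq_eval_zero P
  have hnd : ((n - d : ℕ) : ℚ) = n - d := Nat.cast_sub (by omega)
  simp [Polynomial.derivative_pow, hnd] at h0 h1
  rw [← hp0] at h0
  rw [← hp1, ← hp0] at h1
  have r0 : ((q : ℚ) - 1) * P.coeff 0 = a d := by
    have : P.coeff 0 = ((q : ℚ) - 1)⁻¹ * a d := by linarith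
    rw [this, mul_inv_cancel_left₀ hq0]
  have r1 : ((q : ℚ) - 1) * P.coeff 1 = a (d + 1) - ((q : ℚ) - (d : ℚ)) * a d := by
    have : P.coeff 1 = ((q : ℚ) - 1)⁻¹ * (a (d + 1) - ((q : ℚ) - (d : ℚ)) * a d) := by
      linear_combination h1 + n * h0
    rw [this, mul_inv_cancel_left₀ hq0]
  have hpne : P.coeff 0 ≠ 0 := by
    intro h; rw [h] at r0; simp at r0; linarith
  have r2 : a d * (P.coeff 1 / P.coeff 0 - (d : ℚ) + (q : ℚ)) = a (d + 1) := by
    have : a d * (P.coeff 1 / P.coeff 0) = ((q : ℚ) - 1) * P.coeff 1 := by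
      rw [← r0]; field_simp
    linear_combination this + r1
  refine ⟨r0, r1, r2, ?_⟩
  have := nonneg_of_mul_nonneg_right (r2 ▸ had1) had
  linarith

end
end

section
/- For a polynomial P(T) = Σ_{j=0}^{n−d} p_j T^j ∈ ℚ[T] of degree at most n − d, the following two conditions are equivalent: (1) the polynomial identity in ℚ[x,y]: Σ_{i=0}^{n−d} ( Σ_{j=0}^{n−d−i} p_j · (q^{n−d−i−j+1} − 1)/(q−1) ) · binom(n,i) · (x−y)^i y^{n−i} = (A(x,y) − x^n)/(q−1), where A(x,y) = Σ_{w=0}^{n} A_w x^{n−w} y^w; (2) the polynomial congruence P(T)·(1−T)^n ≡ (1−qT)·(1/(q−1))·Σ_{w=d}^{n} a_w T^{w−d}(1−T)^{n−w} (mod T^{n−d+1}). -/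
open Finset Polynomial

noncomputable section

variable {F : Type*} [Field F] [Fintype F] {ι : Type*} [Fintype ι]

theorem aux_geom (q : ℚ) (hq : q - 1 ≠ 0) :
    (1 - PowerSeries.X : PowerSeries ℚ) * (1 - PowerSeries.C q * PowerSeries.X) *
      PowerSeries.mk (fun k => (q ^ (k + 1) - 1) / (q - 1)) = 1 := by
  have h1 : (1 - PowerSeries.C q * PowerSeries.X) *
      PowerSeries.mk (fun k => (q ^ (k + 1) - 1) / (q - 1)) =
      PowerSeries.mk (fun _ => (1 : ℚ)) := by
    ext k
    rw [sub_mul, one_mul, map_sub, mul_assoc, PowerSeries.coeff_C_mul]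
    cases k with
    | zero => simp [hq]
    | succ k =>
      rw [PowerSeries.coeff_succ_X_mul]
      simp only [PowerSeries.coeff_mk]
      field_simp
      ring
  rw [mul_assoc, h1, mul_comm]
  exact PowerSeries.mk_one_mul_one_sub_eq_one ℚ

theorem aux_choose (n d w : ℕ) (hdw : d ≤ w) (hwn : w ≤ n) :
    (1 - PowerSeries.X : PowerSeries ℚ) ^ (n + 1) *
      PowerSeries.mk (fun k => ((d + k).choose w : ℚ)) =
    PowerSeries.X ^ (w - d) * (1 - PowerSeries.X) ^ (n - w) := by
  have h1 : PowerSeries.mk (fun k => ((d + k).choose w : ℚ)) =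
      PowerSeries.X ^ (w - d) * PowerSeries.mk (fun k => ((w + k).choose w : ℚ)) := by
    ext k
    rw [PowerSeries.coeff_X_pow_mul', PowerSeries.coeff_mk]
    split_ifs with h
    · rw [PowerSeries.coeff_mk]
      congr 2
      omega
    · rw [Nat.choose_eq_zero_of_lt (by omega)]; simp
  have h2 := PowerSeries.mk_add_choose_mul_one_sub_pow_eq_one ℚ w
  have h3 : n + 1 = (n - w) + (w + 1) := by omega
  rw [h1, h3, pow_add]
  calc _ = PowerSeries.X ^ (w - d) * (1 - PowerSeries.X) ^ (n - w) *
      (PowerSeries.mk (fun k => ((w + k).choose w : ℚ)) * (1 - PowerSeries.X) ^ (w + 1)) := by ring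
    _ = _ := by rw [h2, mul_one]

theorem aux_congr (q n d : ℕ) (hq : (q : ℚ) - 1 ≠ 0) (a : ℕ → ℚ) (P : ℚ[X]) :
    zetaCongr q n d a P ↔ ∀ k < n - d + 1,
      ∑ j ∈ Finset.range (k + 1), P.coeff j * (((q : ℚ) ^ (k - j + 1) - 1) / ((q : ℚ) - 1))
       = ((q : ℚ) - 1)⁻¹ * ∑ w ∈ Finset.Icc d n, a w * ((d + k).choose w : ℚ) := by
  set G : PowerSeries ℚ := (P : PowerSeries ℚ) *
    PowerSeries.mk (fun k => ((q : ℚ) ^ (k + 1) - 1) / ((q : ℚ) - 1)) with hG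
  set H : PowerSeries ℚ := PowerSeries.C ((q : ℚ) - 1)⁻¹ * ∑ w ∈ Finset.Icc d n,
    PowerSeries.C (a w) * PowerSeries.mk (fun k => ((d + k).choose w : ℚ)) with hH
  have hGH : ((P * (1 - X) ^ n -
      (1 - Polynomial.C (q : ℚ) * X) * Polynomial.C (((q : ℚ) - 1)⁻¹) *
        ∑ w ∈ Finset.Icc d n, Polynomial.C (a w) * X ^ (w - d) * (1 - X) ^ (n - w) : ℚ[X]) :
        PowerSeries ℚ) = ((1 - PowerSeries.X) ^ (n + 1) *
          (1 - PowerSeries.C (q : ℚ) * PowerSeries.X)) * (G - H) := by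
    have e1 : (1 - PowerSeries.X) ^ (n + 1) * H = PowerSeries.C ((q : ℚ) - 1)⁻¹ *
        ∑ w ∈ Finset.Icc d n, PowerSeries.C (a w) * PowerSeries.X ^ (w - d) *
          (1 - PowerSeries.X) ^ (n - w) := by
      rw [hH, mul_left_comm, Finset.mul_sum]
      congr 1
      refine Finset.sum_congr rfl fun w hw => ?_
      rw [Finset.mem_Icc] at hw
      rw [mul_left_comm, aux_choose n d w hw.1 hw.2, mul_assoc]
    have e2 := aux_geom (q : ℚ) hq
    have e3 : ((1 - PowerSeries.X) ^ (n + 1) *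
          (1 - PowerSeries.C (q : ℚ) * PowerSeries.X)) * (G - H) =
        (P : PowerSeries ℚ) * (1 - PowerSeries.X) ^ n * ((1 - PowerSeries.X : PowerSeries ℚ) * (1 - PowerSeries.C (q : ℚ) * PowerSeries.X) *
      PowerSeries.mk (fun k => ((q : ℚ) ^ (k + 1) - 1) / ((q : ℚ) - 1))) -
        (1 - PowerSeries.C (q : ℚ) * PowerSeries.X) * ((1 - PowerSeries.X) ^ (n + 1) * H) := by
      rw [hG]; ring
    rw [e3, e1, e2]
    have hs : ∀ s : Finset ℕ, ∀ f : ℕ → ℚ[X], ((∑ w ∈ s, f w : ℚ[X]) : PowerSeries ℚ) =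
        ∑ w ∈ s, (f w : PowerSeries ℚ) := fun s f =>
      map_sum (Polynomial.coeToPowerSeries.ringHom (R := ℚ)) f s
    simp only [Polynomial.coe_sub, Polynomial.coe_mul, Polynomial.coe_pow, Polynomial.coe_one,
      Polynomial.coe_X, Polynomial.coe_C, hs, mul_one, mul_assoc]
  have hunit : IsUnit ((1 - PowerSeries.X : PowerSeries ℚ) ^ (n + 1) *
          (1 - PowerSeries.C (q : ℚ) * PowerSeries.X)) := by
    rw [PowerSeries.isUnit_iff_constantCoeff]; simp
  unfold zetaCongr
  rw [Polynomial.X_pow_dvd_iff]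
  simp only [← Polynomial.coeff_coe]
  rw [← PowerSeries.X_pow_dvd_iff, hGH, hunit.dvd_mul_left, PowerSeries.X_pow_dvd_iff]
  refine forall₂_congr fun k hk => ?_
  rw [map_sub, sub_eq_zero, hG, hH, PowerSeries.coeff_mul,
    Finset.Nat.sum_antidiagonal_eq_sum_range_succ_mk, PowerSeries.coeff_C_mul, map_sum]
  simp only [PowerSeries.coeff_C_mul, PowerSeries.coeff_mk, Polynomial.coeff_coe]

theorem aux_poly (n m : ℕ) (hm : m ≤ n) (c : ℕ → ℚ)
    (h : ∀ x y : ℚ, ∑ i ∈ Finset.range (m + 1),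
      c i * (n.choose i : ℚ) * (x - y) ^ i * y ^ (n - i) = 0) : ∀ i ≤ m, c i = 0 := by
  have hp : ∑ i ∈ Finset.range (m + 1), Polynomial.monomial i (c i * (n.choose i : ℚ)) = 0 := by
    apply Polynomial.funext
    intro t
    have := h (t + 1) 1
    simpa [Polynomial.eval_finset_sum] using this
  intro i hi
  have := congrArg (fun p => Polynomial.coeff p i) hp
  simp [Polynomial.finset_sum_coeff, Polynomial.coeff_monomial] at this
  rcases this (by omega) with h | h
  · exact h
  · exact absurd (Nat.choose_pos (hi.trans hm)) (by omega)

theorem aux_expand (n d : ℕ) (hdn : d ≤ n) (a A : ℕ → ℚ) (ha : ∀ w, a w = A w / (n.choose w))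
    (x y : ℚ) : ∑ w ∈ Finset.Icc d n, A w * x ^ (n - w) * y ^ w =
      ∑ i ∈ Finset.range (n - d + 1),
        (∑ w ∈ Finset.Icc d n, a w * ((d + (n - d - i)).choose w : ℚ)) * (n.choose i : ℚ) *
          (x - y) ^ i * y ^ (n - i) := by
  simp only [Finset.sum_mul]
  rw [Finset.sum_comm]
  refine Finset.sum_congr rfl fun w hw => ?_
  rw [Finset.mem_Icc] at hw
  have hsub : Finset.range (n - w + 1) ⊆ Finset.range (n - d + 1) := by
    intro i; simp only [Finset.mem_range]; omega
  rw [← Finset.sum_subset hsub]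
  · have hx : x ^ (n - w) = ((x - y) + y) ^ (n - w) := by ring
    rw [hx, add_pow, Finset.mul_sum, Finset.sum_mul]
    refine Finset.sum_congr rfl fun i hi => ?_
    rw [Finset.mem_range] at hi
    have e1 : d + (n - d - i) = n - i := by omega
    have e2 : n - i = (n - w - i) + w := by omega
    have hne : (n.choose w : ℚ) ≠ 0 := by
      exact_mod_cast (Nat.choose_pos hw.2).ne'
    have hc : (n.choose w : ℚ) * ((n - w).choose i : ℚ) =
        (n.choose i : ℚ) * ((n - i).choose w : ℚ) := by
      have h1 := Nat.choose_mul (n := n) (k := i + w) (s := w) (by omega)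
      have h2 := Nat.choose_mul (n := n) (k := i + w) (s := i) (by omega)
      have h3 : (i + w).choose w = (i + w).choose i := by
        rw [Nat.choose_symm_add]
      simp only [Nat.add_sub_cancel, Nat.add_sub_cancel_left] at h1 h2
      rw [h3, h2] at h1
      exact_mod_cast h1.symm
    rw [e1, ha]
    have hA : A w = A w / (n.choose w : ℚ) * n.choose w := by field_simp
    have e3 : y ^ (n - i) = y ^ (n - w - i) * y ^ w := by rw [← pow_add, ← e2]
    rw [e3]
    nth_rewrite 1 [hA]
    linear_combination (A w / (n.choose w : ℚ)) * (x - y) ^ i * y ^ (n - w - i) * y ^ w * hc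
  · intro i hi hi'
    simp only [Finset.mem_range] at hi hi'
    rw [Nat.choose_eq_zero_of_lt (by omega)]
    simp

theorem aux_wt_zero {F : Type*} [Field F] {n : ℕ} (x : Fin n → F) : wt x = 0 ↔ x = 0 := by
  unfold wt
  rw [Set.ncard_eq_zero (Set.toFinite _)]
  constructor
  · intro h
    ext i
    by_contra hi
    have : i ∈ {i | x i ≠ 0} := hi
    rw [h] at this
    exact this
  · rintro rfl; simp

theorem aux_sum {F : Type*} [Field F] [Fintype F] {n : ℕ}
    (Γ : Submodule F (Fin n → F)) (d : ℕ) (hd : d = minDist Γ) (hd1 : 1 ≤ d) (x y : ℚ) :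
    (∑ w ∈ Finset.range (n + 1), (wtCount Γ w : ℚ) * x ^ (n - w) * y ^ w) - x ^ n =
    ∑ w ∈ Finset.Icc d n, (wtCount Γ w : ℚ) * x ^ (n - w) * y ^ w := by
  have h0 : wtCount Γ 0 = 1 := by
    unfold wtCount
    rw [Set.ncard_eq_one]
    refine ⟨0, ?_⟩
    ext v
    simp only [Set.mem_setOf_eq, Set.mem_singleton_iff, aux_wt_zero]
    constructor
    · exact fun h => h.2
    · rintro rfl; exact ⟨Γ.zero_mem, rfl⟩
  have hlt : ∀ w, 0 < w → w < d → wtCount Γ w = 0 := by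
    intro w hw hwd
    unfold wtCount
    rw [Set.ncard_eq_zero (Set.toFinite _), Set.eq_empty_iff_forall_notMem]
    rintro v ⟨hv, hvw⟩
    have : w ∉ {w | ∃ x ∈ Γ, x ≠ 0 ∧ wt x = w} := by
      apply Nat.notMem_of_lt_sInf
      rw [hd] at hwd
      exact hwd
    refine this ⟨v, hv, ?_, hvw⟩
    intro h
    rw [← aux_wt_zero] at h
    omega
  rw [Finset.sum_range_succ', h0]
  simp only [Nat.cast_one, one_mul, Nat.sub_zero, pow_zero, mul_one, add_sub_cancel_right]
  have hs : ∑ k ∈ Finset.range n, (wtCount Γ (k + 1) : ℚ) * x ^ (n - (k + 1)) * y ^ (k + 1) =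
      ∑ w ∈ Finset.Icc 1 n, (wtCount Γ w : ℚ) * x ^ (n - w) * y ^ w := by
    rw [Finset.sum_bij (fun k _ => k + 1)]
    · intro k hk; simp only [Finset.mem_range, Finset.mem_Icc] at *; omega
    · intro k _ l _ h; omega
    · intro b hb
      rw [Finset.mem_Icc] at hb
      exact ⟨b - 1, by rw [Finset.mem_range]; omega, by omega⟩
    · intros; rfl
  rw [hs]
  symm
  apply Finset.sum_subset
  · intro w; simp only [Finset.mem_Icc]; omega
  · intro w hw hw'
    simp only [Finset.mem_Icc] at hw hw'
    rw [hlt w (by omega) (by omega)]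
    simp

theorem aux_le {F : Type*} [Field F] {n : ℕ}
    (Γ : Submodule F (Fin n → F)) (hΓ : Γ ≠ ⊥) : minDist Γ ≤ n := by
  obtain ⟨v, hv, hv0⟩ := Submodule.exists_mem_ne_zero_of_ne_bot hΓ
  have h1 : minDist Γ ≤ wt v := Nat.sInf_le (show wt v ∈ {w | ∃ x ∈ Γ, x ≠ 0 ∧ wt x = w} from
    ⟨v, hv, hv0, rfl⟩)
  refine h1.trans ?_
  unfold wt
  refine (Set.ncard_le_card _).trans ?_
  simp

/-- equivalence of the two definitions of the zeta polynomial. -/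
theorem stmt_7 {F : Type*} [Field F] [Fintype F] {n : ℕ}
    (Γ : Submodule F (Fin n → F)) (hΓ : Γ ≠ ⊥)
    (q d : ℕ) (hq : q = Fintype.card F)
    (hd : d = minDist Γ) (hd1 : 1 ≤ d)
    (a : ℕ → ℚ) (ha : ∀ w, a w = (wtCount Γ w : ℚ) / (n.choose w))
    (P : ℚ[X]) (hdeg : P.natDegree ≤ n - d) :
    (∀ x y : ℚ,
        ∑ i ∈ Finset.range (n - d + 1),
          (∑ j ∈ Finset.range (n - d - i + 1),
              P.coeff j * (((q : ℚ) ^ (n - d - i - j + 1) - 1) / ((q : ℚ) - 1))) *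
            (n.choose i : ℚ) * (x - y) ^ i * y ^ (n - i)
          = ((∑ w ∈ Finset.range (n + 1),
                (wtCount Γ w : ℚ) * x ^ (n - w) * y ^ w) - x ^ n) / ((q : ℚ) - 1))
      ↔ zetaCongr q n d a P := by
  have hdn : d ≤ n := hd ▸ aux_le Γ hΓ
  have hq1 : (q : ℚ) - 1 ≠ 0 := by
    have h1 : 1 < q := hq ▸ Fintype.one_lt_card
    have h2 : (1 : ℚ) < q := by exact_mod_cast h1
    exact (sub_pos.mpr h2).ne'
  rw [aux_congr q n d hq1]
  have hR : ∀ x y : ℚ, ((∑ w ∈ Finset.range (n + 1),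
      (wtCount Γ w : ℚ) * x ^ (n - w) * y ^ w) - x ^ n) / ((q : ℚ) - 1) =
      ∑ i ∈ Finset.range (n - d + 1),
        (((q : ℚ) - 1)⁻¹ * ∑ w ∈ Finset.Icc d n, a w * ((d + (n - d - i)).choose w : ℚ)) *
          (n.choose i : ℚ) * (x - y) ^ i * y ^ (n - i) := by
    intro x y
    rw [aux_sum Γ d hd hd1, aux_expand n d hdn a (fun w => (wtCount Γ w : ℚ)) ha, div_eq_inv_mul,
      Finset.mul_sum]
    exact Finset.sum_congr rfl fun i _ => by ring
  simp only [hR]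
  constructor
  · intro h k hk
    have := aux_poly n (n - d) (by omega) (fun i =>
      (∑ j ∈ Finset.range (n - d - i + 1),
        P.coeff j * (((q : ℚ) ^ (n - d - i - j + 1) - 1) / ((q : ℚ) - 1))) -
      ((q : ℚ) - 1)⁻¹ * ∑ w ∈ Finset.Icc d n, a w * ((d + (n - d - i)).choose w : ℚ)) (by
        intro x y
        have h' := h x y
        rw [← sub_eq_zero, ← Finset.sum_sub_distrib] at h'
        rw [← h']
        exact Finset.sum_congr rfl fun i _ => by ring) (n - d - k) (by omega)
    have e : n - d - (n - d - k) = k := by omega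
    simp only [e] at this
    exact sub_eq_zero.mp this
  · intro h x y
    refine Finset.sum_congr rfl fun i hi => ?_
    rw [h (n - d - i) (by omega)]

end
end

section
/- Define the averaged punctured weight distribution by A'_i = ((n−i)·A_i + (i+1)·A_{i+1})/n for 0 ≤ i ≤ n−1, and set a'_w = A'_w / binom(n−1, w). Then the following congruence of polynomials in ℚ[t] holds: ( Σ_{w=d−1}^{n−1} a'_w · t^{w−(d−1)} ) · (1+t)^{d−1} ≡ ( Σ_{w=d}^{n} a_w · t^{w−d} ) · (1+t)^{d} (mod t^{n−d+1}). -/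
open Finset Polynomial

noncomputable section

variable {F : Type*} [Field F] [Fintype F] {ι : Type*} [Fintype ι]

/-- the normalized weight enumerator congruence is invariant
under (averaged) puncturing. -/
theorem stmt_8 {F : Type*} [Field F] [Fintype F] {n : ℕ}
    (Γ : Submodule F (Fin n → F)) (hΓ : Γ ≠ ⊥)
    (d : ℕ) (hd : d = minDist Γ) (hd2 : 2 ≤ d)
    (a : ℕ → ℚ) (ha : ∀ w, a w = (wtCount Γ w : ℚ) / (n.choose w))
    (A' : ℕ → ℚ)
    (hA' : ∀ i, i ≤ n - 1 →
      A' i = (((n - i : ℕ) : ℚ) * (wtCount Γ i : ℚ)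
              + ((i + 1 : ℕ) : ℚ) * (wtCount Γ (i + 1) : ℚ)) / (n : ℚ))
    (a' : ℕ → ℚ) (ha' : ∀ w, a' w = A' w / ((n - 1).choose w)) :
    (X : ℚ[X]) ^ (n - d + 1) ∣
      (∑ w ∈ Finset.Icc (d - 1) (n - 1), Polynomial.C (a' w) * X ^ (w - (d - 1))) *
          (1 + X) ^ (d - 1)
        - (∑ w ∈ Finset.Icc d n, Polynomial.C (a w) * X ^ (w - d)) * (1 + X) ^ d := by
  have hne : ∃ x ∈ Γ, x ≠ 0 := (Submodule.ne_bot_iff Γ).1 hΓ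
  have hmem : d ∈ {w | ∃ x ∈ Γ, x ≠ 0 ∧ wt x = w} := by
    rw [hd]
    obtain ⟨x, hx, hx0⟩ := hne
    exact Nat.sInf_mem ⟨wt x, x, hx, hx0, rfl⟩
  have hdn : d ≤ n := by
    obtain ⟨x, -, -, rfl⟩ := hmem
    unfold wt
    calc Set.ncard {i | x i ≠ 0} ≤ Nat.card (Fin n) := Set.ncard_le_card _
      _ = n := by simp
  have hzero : wtCount Γ (d - 1) = 0 := by
    have hempty : {x | x ∈ Γ ∧ wt x = d - 1} = ∅ := by
      ext x
      simp only [Set.mem_ofPred_eq, Set.mem_empty_iff_false, iff_false, not_and]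
      intro hx hw
      have hx0 : x ≠ 0 := by
        rintro rfl
        have h0 : wt (0 : Fin n → F) = 0 := by simp [wt]
        omega
      have : minDist Γ ≤ d - 1 := Nat.sInf_le ⟨x, hx, hx0, hw⟩
      omega
    unfold wtCount
    rw [hempty, Set.ncard_empty]
  obtain ⟨e, rfl⟩ : ∃ e, d = e + 1 := ⟨d - 1, by omega⟩
  obtain ⟨k, rfl⟩ : ∃ k, n = e + 1 + k := ⟨n - (e + 1), by omega⟩
  have hae : a e = 0 := by
    rw [ha]
    have : wtCount Γ e = 0 := by simpa using hzero
    simp [this]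
  have key : ∀ w, w ≤ e + k → a' w = a w + a (w + 1) := by
    intro w hw
    obtain ⟨m, hm⟩ : ∃ m, e + k = w + m := ⟨e + k - w, by omega⟩
    have hn1 : e + 1 + k = (w + m) + 1 := by omega
    rw [ha', hA' w (by omega), ha, ha]
    have h1 : e + 1 + k - 1 = w + m := by omega
    have h2 : e + 1 + k - w = m + 1 := by omega
    rw [h1, h2]
    generalize wtCount Γ w = u
    generalize wtCount Γ (w + 1) = v
    rw [hn1]
    have c1 : (w + m + 1) * (w + m).choose w = (w + m + 1).choose (w + 1) * (w + 1) :=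
      Nat.add_one_mul_choose_eq (w + m) w
    have c2 : (w + m).choose w * (w + m + 1) = (w + m + 1).choose w * (m + 1) := by
      have := Nat.choose_mul_succ_eq (w + m) w
      rwa [show w + m + 1 - w = m + 1 by omega] at this
    have p0 : ((w + m).choose w : ℚ) ≠ 0 := by
      exact_mod_cast (Nat.choose_pos (by omega)).ne'
    have p1 : ((w + m + 1).choose w : ℚ) ≠ 0 := by
      exact_mod_cast (Nat.choose_pos (by omega)).ne'
    have p2 : ((w + m + 1).choose (w + 1) : ℚ) ≠ 0 := by
      exact_mod_cast (Nat.choose_pos (by omega)).ne'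
    have p3 : ((w + m + 1 : ℕ) : ℚ) ≠ 0 := by exact Nat.cast_ne_zero.2 (Nat.succ_ne_zero (w + m))
    have c1' : ((w + m + 1 : ℕ) : ℚ) * (w + m).choose w
        = (w + m + 1).choose (w + 1) * ((w + 1 : ℕ) : ℚ) := by exact_mod_cast c1
    have c2' : ((w + m).choose w : ℚ) * ((w + m + 1 : ℕ) : ℚ)
        = (w + m + 1).choose w * ((m + 1 : ℕ) : ℚ) := by exact_mod_cast c2
    generalize ((w + m + 1 : ℕ) : ℚ) = N at *
    generalize ((w + 1 : ℕ) : ℚ) = W at *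
    generalize ((m + 1 : ℕ) : ℚ) = M at *
    rw [add_div, add_div]
    congr 1
    · rw [div_div, div_eq_div_iff (mul_ne_zero p3 p0) p1]
      linear_combination (-(u : ℚ)) * c2'
    · rw [div_div, div_eq_div_iff (mul_ne_zero p3 p0) p2]
      linear_combination (-(v : ℚ)) * c1'
  have s1 : (∑ w ∈ Finset.Icc (e + 1 - 1) (e + 1 + k - 1),
      Polynomial.C (a' w) * (X : ℚ[X]) ^ (w - (e + 1 - 1)))
      = ∑ j ∈ Finset.range (k + 1), Polynomial.C (a' (e + j)) * X ^ j := by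
    rw [show Finset.Icc (e + 1 - 1) (e + 1 + k - 1) = Finset.Ico e (e + k + 1) by
      ext; simp only [Finset.mem_Icc, Finset.mem_Ico]; omega, Finset.sum_Ico_eq_sum_range]
    rw [show e + k + 1 - e = k + 1 by omega]
    simp
  have s2 : (∑ w ∈ Finset.Icc (e + 1) (e + 1 + k),
      Polynomial.C (a w) * (X : ℚ[X]) ^ (w - (e + 1)))
      = ∑ j ∈ Finset.range (k + 1), Polynomial.C (a (e + j + 1)) * X ^ j := by
    rw [show Finset.Icc (e + 1) (e + 1 + k) = Finset.Ico (e + 1) (e + 1 + k + 1) by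
      ext; simp only [Finset.mem_Icc, Finset.mem_Ico]; omega, Finset.sum_Ico_eq_sum_range]
    rw [show e + 1 + k + 1 - (e + 1) = k + 1 by omega]
    refine Finset.sum_congr rfl fun j _ => ?_
    rw [show e + 1 + j - (e + 1) = j by omega, show e + 1 + j = e + j + 1 by omega]
  have s3 : (∑ j ∈ Finset.range (k + 1), Polynomial.C (a' (e + j)) * (X : ℚ[X]) ^ j)
      = (∑ j ∈ Finset.range (k + 1), Polynomial.C (a (e + j)) * X ^ j)
        + ∑ j ∈ Finset.range (k + 1), Polynomial.C (a (e + j + 1)) * X ^ j := by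
    rw [← Finset.sum_add_distrib]
    refine Finset.sum_congr rfl fun j hj => ?_
    rw [Finset.mem_range] at hj
    rw [key (e + j) (by omega), Polynomial.C_add, add_mul]
  have s4 : (∑ j ∈ Finset.range (k + 1), Polynomial.C (a (e + j)) * (X : ℚ[X]) ^ j)
      = X * (∑ j ∈ Finset.range (k + 1), Polynomial.C (a (e + j + 1)) * X ^ j)
        - Polynomial.C (a (e + k + 1)) * X ^ (k + 1) := by
    rw [Finset.sum_range_succ', Finset.sum_range_succ _ k, mul_add, Finset.mul_sum]
    have : ∀ j, Polynomial.C (a (e + (j + 1))) * (X : ℚ[X]) ^ (j + 1)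
        = X * (Polynomial.C (a (e + j + 1)) * X ^ j) := by
      intro j
      rw [← add_assoc]
      ring
    simp only [this, add_zero, hae, Polynomial.C_0, zero_mul]
    ring
  rw [s1, s2, s3, s4, show e + 1 + k - (e + 1) + 1 = k + 1 by omega,
    show e + 1 - 1 = e by omega]
  refine ⟨-(Polynomial.C (a (e + k + 1)) * (1 + X) ^ e), ?_⟩
  ring

end
end

section
/- (Mallows–Sloane bound, Type I) If C is a binary self-dual code of length n > 0 (that is, C = C⊥ in F_2^n), then its minimum distance satisfies d ≤ 2·⌊n/8⌋ + 2. -/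
open Finset Polynomial

noncomputable section

variable {F : Type*} [Field F] [Fintype F] {ι : Type*} [Fintype ι]

theorem ms_sym (a : ℝ) (k : ℕ) : ∀ p : ℝ[X], p.natDegree ≤ k → p.comp (C a - X) = p →
    ∃ P : ℝ[X], p = P.comp (X * (C a - X)) := by
  induction k using Nat.strong_induction_on with
  | _ k ih =>
  intro p hk hp
  by_cases h0 : p.natDegree = 0
  · obtain ⟨c, rfl⟩ := natDegree_eq_zero.mp h0
    exact ⟨C c, by simp⟩
  -- divide by the monic quadratic
  set D : ℝ[X] := X ^ 2 - C a * X with hD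
  have hDm : D.Monic := by
    rw [hD]; monicity!
  have hDdeg : D.natDegree = 2 := by
    rw [hD]; compute_degree!
  have hDc : D.comp (C a - X) = D := by
    rw [hD]; simp; ring
  set q := p /ₘ D with hq
  set r := p %ₘ D with hr
  have hpd : r + D * q = p := modByMonic_add_div p D
  have hrd : r.natDegree < 2 := by
    rw [← hDdeg]
    apply natDegree_modByMonic_lt p hDm
    intro h; rw [h] at hDdeg; simp at hDdeg
  have hcd : (C a - X : ℝ[X]).natDegree = 1 := by compute_degree!
  have hu := div_modByMonic_unique (f := p) (g := D) (q.comp (C a - X)) (r.comp (C a - X)) hDm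
    ⟨by
      conv_rhs => rw [← hp, ← hpd]
      rw [add_comp, mul_comp, hDc], by
      apply degree_lt_degree
      rw [natDegree_comp, hcd, hDdeg]; omega⟩
  have hqs : q.comp (C a - X) = q := hu.1.symm
  have hrs : r.comp (C a - X) = r := hu.2.symm
  have hr1 : r = C (r.coeff 1) * X + C (r.coeff 0) :=
    eq_X_add_C_of_natDegree_le_one (by omega)
  have hb : r.coeff 1 = 0 := by
    have := hrs
    rw [hr1] at this
    simp only [add_comp, mul_comp, C_comp, X_comp] at this
    have h1 := congrArg (fun s => s.eval (a / 2 + 1)) this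
    simp only [eval_add, eval_mul, eval_sub, eval_C, eval_X] at h1
    linarith
  have hqd : q.natDegree < p.natDegree := by
    rw [hq, natDegree_divByMonic p hDm, hDdeg]; omega
  obtain ⟨P, hP⟩ := ih q.natDegree (lt_of_lt_of_le hqd hk) q le_rfl hqs
  refine ⟨C (r.coeff 0) - X * P, ?_⟩
  rw [hb] at hr1
  simp only [sub_comp, mul_comp, C_comp, X_comp, ← hP]
  rw [← hpd]
  conv_lhs => rw [hr1]
  rw [hD]; simp; ring

theorem ms_gleason (g : ℝ[X]) (hg : ∀ θ : ℝ, g.eval (Real.cos θ) = g.eval (Real.sin θ)) :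
    ∃ P : ℝ[X], g = P.comp (X ^ 2 * (1 - X ^ 2)) := by
  have hinf : (Set.Icc (-1 : ℝ) 1).Infinite := Set.Icc_infinite (by norm_num)
  have hinf' : (Set.Icc (-1 : ℝ) 0).Infinite := Set.Icc_infinite (by norm_num)
  have he : g.comp (C 0 - X) = g := by
    apply eq_of_infinite_eval_eq
    refine hinf.mono ?_
    intro t ht
    obtain ⟨h1, h2⟩ := ht
    have a1 := hg (Real.arcsin t)
    have a2 := hg (-Real.arcsin t)
    rw [Real.cos_neg, Real.sin_neg, Real.sin_arcsin h1 h2] at a2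
    rw [Real.sin_arcsin h1 h2] at a1
    simp only [Set.mem_ofPred_eq, eval_comp, eval_sub, eval_C, eval_X, zero_sub]
    rw [← a2, a1]
  obtain ⟨P1, h1⟩ := ms_sym 0 _ g le_rfl he
  have h2 : P1.comp (C (-1) - X) = P1 := by
    apply eq_of_infinite_eval_eq
    refine hinf'.mono ?_
    intro t ht
    obtain ⟨ht1, ht2⟩ := ht
    set s := Real.sqrt (-t)
    have hs : s ^ 2 = -t := Real.sq_sqrt (by linarith)
    have hs0 : 0 ≤ s := Real.sqrt_nonneg _
    have hs1 : s ≤ 1 := by nlinarith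
    have a1 := hg (Real.arcsin s)
    have hc := Real.sin_sq_add_cos_sq (Real.arcsin s)
    rw [Real.sin_arcsin (by linarith) hs1] at a1 hc
    rw [h1] at a1
    simp only [eval_comp, eval_mul, eval_sub, eval_C, eval_X, zero_sub] at a1
    simp only [Set.mem_ofPred_eq, eval_comp, eval_sub, eval_C, eval_X]
    have e1 : Real.cos (Real.arcsin s) * -Real.cos (Real.arcsin s) = -1 - t := by nlinarith
    have e2 : s * -s = t := by nlinarith
    rw [e1, e2] at a1
    exact a1
  obtain ⟨P, h3⟩ := ms_sym (-1) _ P1 le_rfl h2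
  refine ⟨P, ?_⟩
  rw [h1, h3, comp_assoc]
  congr 1
  simp
  ring

/-- Residue-type identity. -/
theorem ms_res (u v : PowerSeries ℝ) (huv : u * v = 1) (k : ℕ) :
    PowerSeries.coeff (k + 1)
      (PowerSeries.derivative ℝ (PowerSeries.X * u) * v ^ (k + 2)) = 0 := by
  set d := PowerSeries.derivative ℝ with hd
  change PowerSeries.coeff (k + 1) (d (PowerSeries.X * u) * v ^ (k + 2)) = 0
  have h1 : d (PowerSeries.X * u) = PowerSeries.X * d u + u := by
    rw [Derivation.leibniz]; simp [hd, smul_eq_mul]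
  have h2 : d u * v + u * d v = 0 := by
    have := congrArg d huv
    rw [Derivation.leibniz] at this
    simp [smul_eq_mul] at this
    linear_combination this
  have h3 : d (v ^ (k + 1)) = ((k + 1 : ℕ) : PowerSeries ℝ) * (v ^ k * d v) := by
    rw [Derivation.leibniz_pow]; simp [smul_eq_mul]
  have h4 : d (PowerSeries.X * u) * v ^ (k + 2) = v ^ (k + 1) - PowerSeries.X * (v ^ k * d v) := by
    rw [h1]
    linear_combination (v ^ (k + 1) - PowerSeries.X * v ^ k * d v) * huv
      + PowerSeries.X * v ^ (k + 1) * h2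
  have h5 := congrArg (PowerSeries.coeff k) h3
  have h6 : PowerSeries.coeff k (d (v ^ (k + 1)))
      = PowerSeries.coeff (k + 1) (v ^ (k + 1)) * (k + 1) := by
    rw [hd]; exact PowerSeries.coeff_derivative _ _
  rw [h6, ← map_natCast (PowerSeries.C (R := ℝ)), PowerSeries.coeff_C_mul] at h5
  rw [h4, map_sub, PowerSeries.coeff_succ_X_mul]
  have hk : ((k : ℝ) + 1) ≠ 0 := by positivity
  push_cast at h5
  have : (k + 1 : ℝ) * (PowerSeries.coeff (k + 1) (v ^ (k + 1))
      - PowerSeries.coeff k (v ^ k * d v)) = 0 := by linarith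
  exact (mul_eq_zero.mp this).resolve_left hk

open PowerSeries in
theorem ms_nonneg_mul (a b : PowerSeries ℝ) (ha : ∀ i, 0 ≤ coeff i a)
    (hb : ∀ i, 0 ≤ coeff i b) (i : ℕ) : 0 ≤ coeff i (a * b) := by
  rw [PowerSeries.coeff_mul]
  exact Finset.sum_nonneg fun x _ => mul_nonneg (ha _) (hb _)

open PowerSeries in
theorem ms_nonneg_pow (a : PowerSeries ℝ) (ha : ∀ i, 0 ≤ coeff i a) (k : ℕ) :
    ∀ i, 0 ≤ coeff i (a ^ k) := by
  induction k with
  | zero => intro i; rw [pow_zero, PowerSeries.coeff_one]; split_ifs <;> norm_num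
  | succ k ih => intro i; rw [pow_succ]; exact ms_nonneg_mul _ _ ih ha i

open PowerSeries in
theorem ms_pos_mul (a b : PowerSeries ℝ) (ha : ∀ i, 0 ≤ coeff i a) (ha0 : 0 < coeff 0 a)
    (hb : ∀ i, 0 < coeff i b) (i : ℕ) : 0 < coeff i (a * b) := by
  rw [PowerSeries.coeff_mul]
  apply Finset.sum_pos' (fun x _ => mul_nonneg (ha _) (hb _).le)
  exact ⟨(0, i), by simp, mul_pos ha0 (hb _)⟩

/-- The coefficient argument. -/
theorem ms_core (N m : ℕ) (hN : 0 < N) (hm1 : 4 * m ≤ N) (hm2 : N ≤ 4 * m + 3)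
    (a : ℕ → ℝ) (R : PowerSeries ℝ)
    (h : 1 + PowerSeries.X ^ (m + 2) * R =
      ∑ j ∈ Finset.range (m + 1), PowerSeries.C (a j) *
        ((PowerSeries.X * (1 - PowerSeries.X) ^ 2) ^ j * (1 + PowerSeries.X) ^ (N - 4 * j))) :
    False := by
  obtain ⟨S, hS⟩ : ∃ S : PowerSeries ℝ, (1 + PowerSeries.X) * S = 1 :=
    ⟨_, PowerSeries.mul_inv_cancel _ (by simp)⟩
  set E : PowerSeries ℝ := PowerSeries.mk 1 with hE
  have hE1 : E * (1 - PowerSeries.X) = 1 := PowerSeries.mk_one_mul_one_sub_eq_one ℝ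
  set x : PowerSeries ℝ := PowerSeries.X with hx
  set d := PowerSeries.derivative ℝ with hd
  set u := (1 - x) ^ 2 * S ^ 4 with hu
  set v := (1 + x) ^ 4 * E ^ 2 with hv
  have huv : u * v = 1 := by
    have : u * v = (E * (1 - x)) ^ 2 * ((1 + x) * S) ^ 4 := by rw [hu, hv]; ring
    rw [this, hE1, hS]; simp
  have hdx : d x = 1 := PowerSeries.derivative_X
  have hdS : d S = - S ^ 2 := by
    have := congrArg d hS
    rw [Derivation.leibniz, map_add, hdx] at this
    simp [smul_eq_mul] at this
    linear_combination S * this - d S * hS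
  -- multiply by S^N
  have h1 : (1 + x ^ (m + 2) * R) * S ^ N
      = ∑ j ∈ Finset.range (m + 1), PowerSeries.C (a j) * (x * u) ^ j := by
    rw [h, Finset.sum_mul]
    apply Finset.sum_congr rfl
    intro j hj
    have hj' : j < m + 1 := Finset.mem_range.mp hj
    have e : S ^ N = S ^ (N - 4 * j) * S ^ (4 * j) := by rw [← pow_add]; congr 1; omega
    have e2 : (1 + x) ^ (N - 4 * j) * S ^ (N - 4 * j) = 1 := by rw [← mul_pow, hS, one_pow]
    rw [e, hu]
    calc _ = PowerSeries.C (a j) * ((x * (1 - x) ^ 2) ^ j * S ^ (4 * j)) *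
          ((1 + x) ^ (N - 4 * j) * S ^ (N - 4 * j)) := by ring
      _ = _ := by rw [e2, pow_mul, ← mul_pow]; ring
  have h2 := congrArg (fun f => PowerSeries.coeff m (d f * v ^ (m + 1))) h1
  have hR : PowerSeries.coeff m
      (d (∑ j ∈ Finset.range (m + 1), PowerSeries.C (a j) * (x * u) ^ j) * v ^ (m + 1)) = 0 := by
    clear_value u v
    rw [map_sum, Finset.sum_mul, map_sum]
    apply Finset.sum_eq_zero
    intro j hj
    have hj' : j < m + 1 := Finset.mem_range.mp hj
    rcases j with _ | j
    · simp [hd]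
    obtain ⟨k, rfl⟩ : ∃ k, m = j + (k + 1) := ⟨m - j - 1, by omega⟩
    have e1 : d (PowerSeries.C (a (j + 1)) * (x * u) ^ (j + 1)) * v ^ (j + (k + 1) + 1)
        = PowerSeries.C (a (j + 1) * (j + 1)) *
          (x ^ j * (d (x * u) * v ^ (k + 2))) := by
      rw [Derivation.leibniz, Derivation.leibniz_pow]
      have : d (PowerSeries.C (a (j + 1))) = 0 := by simp [hd]
      rw [this]
      have e3 : (u * v) ^ j = 1 := by rw [huv, one_pow]
      simp only [smul_eq_mul, nsmul_eq_mul, map_mul, map_add, map_natCast, map_one, mul_zero,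
        add_zero, Nat.add_sub_cancel]
      push_cast
      linear_combination (PowerSeries.C (a (j + 1)) * (j + 1) * (x ^ j * (d (x * u) * v ^ (k + 2)))) * e3
    rw [e1, PowerSeries.coeff_C_mul, add_comm j (k + 1), PowerSeries.coeff_X_pow_mul]
    have := ms_res u v huv k
    change PowerSeries.coeff (k + 1) (d (x * u) * v ^ (k + 2)) = 0 at this
    rw [this, mul_zero]
  rw [hR] at h2
  obtain ⟨N', rfl⟩ : ∃ N', N = N' + 1 := ⟨N - 1, by omega⟩
  have h3 : ∃ Q, d ((1 + x ^ (m + 2) * R) * S ^ (N' + 1)) * v ^ (m + 1)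
      = x ^ (m + 1) * Q - PowerSeries.C ((N' : ℝ) + 1) * ((1 + x) ^ (4 * m + 3 - (N' + 1)) * E ^ (2 * m + 2)) := by
    have e0 : S ^ (N' + 2) * (1 + x) ^ (4 * m + 4) = (1 + x) ^ (4 * m + 3 - (N' + 1)) := by
      have : (1 + x) ^ (4 * m + 4) = (1 + x) ^ (N' + 2) * (1 + x) ^ (4 * m + 3 - (N' + 1)) := by
        rw [← pow_add]; congr 1; omega
      rw [this, ← mul_assoc, ← mul_pow, mul_comm S, hS, one_pow, one_mul]
    have e1 : v ^ (m + 1) = (1 + x) ^ (4 * m + 4) * E ^ (2 * m + 2) := by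
      rw [hv, mul_pow, ← pow_mul, ← pow_mul, mul_add, mul_add]
    refine ⟨(d (R * S ^ (N' + 1)) * x + ((m : PowerSeries ℝ) + 2) * (R * S ^ (N' + 1))) * v ^ (m + 1), ?_⟩
    have e2 : (1 + x ^ (m + 2) * R) * S ^ (N' + 1) = S ^ (N' + 1) + x ^ (m + 2) * (R * S ^ (N' + 1)) := by ring
    have e3 : d (S ^ (N' + 1)) = - (((N' : PowerSeries ℝ) + 1) * S ^ (N' + 2)) := by
      rw [Derivation.leibniz_pow, hdS]
      simp only [smul_eq_mul, nsmul_eq_mul, Nat.add_sub_cancel]; push_cast; ring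
    have e4 : d (x ^ (m + 2)) = ((m : PowerSeries ℝ) + 2) * x ^ (m + 1) := by
      rw [Derivation.leibniz_pow, hdx]
      simp [smul_eq_mul, nsmul_eq_mul]
    rw [e2, map_add, e3, Derivation.leibniz, e4, ← e0]
    simp only [smul_eq_mul, map_add, map_natCast, map_one]
    linear_combination (- (((N' : PowerSeries ℝ) + 1) * S ^ (N' + 2))) * e1
  obtain ⟨Q, hQ⟩ := h3
  rw [hQ, map_sub, PowerSeries.coeff_C_mul] at h2
  have h4 : PowerSeries.coeff m (x ^ (m + 1) * Q) = 0 := by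
    rw [PowerSeries.coeff_X_pow_mul']; simp
  have hEp : ∀ i, PowerSeries.coeff i E = 1 := by intro i; simp [hE]
  have hxn : ∀ i, 0 ≤ PowerSeries.coeff i (1 + x) := by
    intro i
    rw [map_add, hx, PowerSeries.coeff_one, PowerSeries.coeff_X]
    split_ifs <;> norm_num
  have h5 : 0 < PowerSeries.coeff m ((1 + x) ^ (4 * m + 3 - (N' + 1)) * E ^ (2 * m + 2)) := by
    rw [pow_succ E, ← mul_assoc]
    apply ms_pos_mul
    · exact ms_nonneg_mul _ _ (ms_nonneg_pow _ hxn _)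
        (ms_nonneg_pow _ (fun i => by rw [hEp]; norm_num) _)
    · simp [hx, hE]
    · intro i; rw [hEp]; norm_num
  rw [h4] at h2
  have : (0 : ℝ) < N' + 1 := by positivity
  nlinarith [mul_pos this h5]

/-- The sign character on `ZMod 2`. -/
def msChi (a : ZMod 2) : ℝ := if a = 0 then 1 else -1

theorem msChi_add (a b : ZMod 2) : msChi (a + b) = msChi a * msChi b := by
  unfold msChi
  have h : ∀ a b : ZMod 2, (a = 0 ∧ b = 0 ∧ a + b = 0) ∨ (a = 0 ∧ b ≠ 0 ∧ a + b ≠ 0) ∨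
    (a ≠ 0 ∧ b = 0 ∧ a + b ≠ 0) ∨ (a ≠ 0 ∧ b ≠ 0 ∧ a + b = 0) := by decide
  rcases h a b with ⟨h1, h2, h3⟩ | ⟨h1, h2, h3⟩ | ⟨h1, h2, h3⟩ | ⟨h1, h2, h3⟩ <;>
    simp only [h1, h2, h3, if_true, if_false] <;> norm_num <;> assumption

theorem msChi_sum {ι : Type*} (s : Finset ι) (f : ι → ZMod 2) :
    msChi (∑ i ∈ s, f i) = ∏ i ∈ s, msChi (f i) := by
  classical
  induction s using Finset.induction_on with
  | empty => simp [msChi]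
  | insert a s ha ih => rw [Finset.sum_insert ha, Finset.prod_insert ha, msChi_add, ih]

theorem ms_wt {n : ℕ} (c : Fin n → ZMod 2) : wt c = (Finset.univ.filter fun i => c i ≠ 0).card := by
  unfold wt
  rw [← Set.ncard_coe_finset]; simp

theorem ms_wt_le {n : ℕ} (c : Fin n → ZMod 2) : wt c ≤ n := by
  rw [ms_wt]; simpa using Finset.card_filter_le (Finset.univ : Finset (Fin n)) (fun i => c i ≠ 0)

theorem ms_prod {n : ℕ} (c : Fin n → ZMod 2) (x y : ℝ) :
    ∏ i, (if c i = 0 then x else y) = x ^ (n - wt c) * y ^ wt c := by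
  rw [Finset.prod_ite, Finset.prod_const, Finset.prod_const, ← ms_wt]
  congr 2
  have := Finset.card_filter_add_card_filter_not (s := (Finset.univ : Finset (Fin n)))
    (fun i => c i = 0)
  rw [Finset.card_univ, Fintype.card_fin] at this
  have h2 := ms_wt c
  simp only [ne_eq] at h2
  omega

open Classical in
/-- The weight enumerator. -/
def msF {n : ℕ} (Γ : Submodule (ZMod 2) (Fin n → ZMod 2)) (x y : ℝ) : ℝ :=
  ∑ c ∈ Finset.univ.filter (fun c => c ∈ Γ), x ^ (n - wt c) * y ^ wt c

open Classical in
theorem ms_charsum {n : ℕ} (Γ : Submodule (ZMod 2) (Fin n → ZMod 2)) (v : Fin n → ZMod 2) :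
    ∑ c ∈ Finset.univ.filter (fun c => c ∈ Γ), msChi (∑ i, v i * c i)
      = if v ∈ dualCode Γ then ((Finset.univ.filter (fun c => c ∈ Γ)).card : ℝ) else 0 := by
  split_ifs with h
  · rw [Finset.card_eq_sum_ones, Nat.cast_sum]
    apply Finset.sum_congr rfl
    intro c hc
    have : ∑ i, v i * c i = 0 := h c (by simpa using hc)
    rw [this]; simp [msChi]
  · have : ∃ b ∈ Γ, ∑ i, v i * b i ≠ 0 := by
      by_contra hcon
      push Not at hcon
      exact h hcon
    obtain ⟨b, hb, hvb⟩ := this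
    have hsum : ∑ c ∈ Finset.univ.filter (fun c => c ∈ Γ), msChi (∑ i, v i * c i)
        = ∑ c ∈ Finset.univ.filter (fun c => c ∈ Γ), msChi (∑ i, v i * (b + c) i) := by
      symm
      apply Finset.sum_bijective (fun c => b + c) (AddGroup.addLeft_bijective b)
      · intro c
        simp only [Finset.mem_filter, Finset.mem_univ, true_and]
        exact (Γ.add_mem_iff_right hb).symm
      · intro c _; rfl
    have hneg : ∀ c, msChi (∑ i, v i * (b + c) i) = - msChi (∑ i, v i * c i) := by
      intro c
      have : ∑ i, v i * (b + c) i = (∑ i, v i * b i) + ∑ i, v i * c i := by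
        rw [← Finset.sum_add_distrib]
        apply Finset.sum_congr rfl
        intro i _; rw [Pi.add_apply, mul_add]
      rw [this, msChi_add]
      have : msChi (∑ i, v i * b i) = -1 := by simp only [msChi, hvb, if_false]
      rw [this]; ring
    simp only [hneg, Finset.sum_neg_distrib] at hsum
    linarith

open Classical in
theorem ms_macwilliams {n : ℕ} (Γ : Submodule (ZMod 2) (Fin n → ZMod 2)) (x y : ℝ) :
    msF Γ (x + y) (x - y) = (Finset.univ.filter (fun c => c ∈ Γ)).card * msF (dualCode Γ) x y := by
  have h1 : ∀ c : Fin n → ZMod 2, (x + y) ^ (n - wt c) * (x - y) ^ wt c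
      = ∑ v : Fin n → ZMod 2, (x ^ (n - wt v) * y ^ wt v) * msChi (∑ i, v i * c i) := by
    intro c
    have e : ∀ i, (if c i = 0 then x + y else x - y)
        = ∑ a : ZMod 2, (if a = 0 then x else y) * msChi (a * c i) := by
      intro i
      have : (Finset.univ : Finset (ZMod 2)) = {0, 1} := by decide
      rw [this, Finset.sum_pair (by decide)]
      by_cases hc : c i = 0 <;> simp [msChi, hc]
      ring
    rw [← ms_prod, Finset.prod_congr rfl (fun i _ => e i), Finset.prod_univ_sum]
    rw [Fintype.piFinset_univ]
    apply Finset.sum_congr rfl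
    intro v _
    rw [Finset.prod_mul_distrib, ms_prod, msChi_sum]
  unfold msF
  rw [Finset.sum_congr rfl (fun c _ => h1 c), Finset.sum_comm]
  simp_rw [← Finset.mul_sum, ms_charsum]
  rw [Finset.sum_filter, Finset.mul_sum]
  apply Finset.sum_congr rfl
  intro v _
  split_ifs <;> ring

theorem ms_F_scale {n : ℕ} (Γ : Submodule (ZMod 2) (Fin n → ZMod 2)) (r x y : ℝ) :
    msF Γ (r * x) (r * y) = r ^ n * msF Γ x y := by
  unfold msF
  rw [Finset.mul_sum]
  apply Finset.sum_congr rfl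
  intro c _
  have : r ^ n = r ^ (n - wt c) * r ^ wt c := by rw [← pow_add, Nat.sub_add_cancel (ms_wt_le c)]
  rw [this]; ring

theorem ms_wt_zero_iff {n : ℕ} (c : Fin n → ZMod 2) : wt c = 0 ↔ c = 0 := by
  rw [ms_wt, Finset.card_eq_zero, Finset.filter_eq_empty_iff]
  simp [funext_iff]

theorem ms_F_one_zero {n : ℕ} (Γ : Submodule (ZMod 2) (Fin n → ZMod 2)) : msF Γ 1 0 = 1 := by
  classical
  unfold msF
  rw [Finset.sum_eq_single 0]
  · simp [(ms_wt_zero_iff (0 : Fin n → ZMod 2)).mpr rfl]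
  · intro c _ hc
    have : wt c ≠ 0 := fun h => hc ((ms_wt_zero_iff c).mp h)
    simp [this]
  · simp

theorem ms_sq : ∀ a : ZMod 2, a * a = a := by decide

theorem ms_sum_eq {n : ℕ} (c : Fin n → ZMod 2) : ∑ i, c i = (wt c : ZMod 2) := by
  rw [ms_wt, Finset.card_eq_sum_ones, Nat.cast_sum, Finset.sum_filter]
  apply Finset.sum_congr rfl
  intro i _
  have : ∀ a : ZMod 2, a = if a ≠ 0 then ((1 : ℕ) : ZMod 2) else 0 := by decide
  exact this _

theorem ms_even {n : ℕ} (Γ : Submodule (ZMod 2) (Fin n → ZMod 2)) (hsd : Γ = dualCode Γ)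
    (c : Fin n → ZMod 2) (hc : c ∈ Γ) : 2 ∣ wt c := by
  have h1 : c ∈ dualCode Γ := hsd ▸ hc
  have h2 : ∑ i, c i * c i = 0 := h1 c hc
  simp only [ms_sq] at h2
  rw [ms_sum_eq] at h2
  exact (ZMod.natCast_eq_zero_iff _ _).mp h2

theorem ms_n_even {n : ℕ} (Γ : Submodule (ZMod 2) (Fin n → ZMod 2)) (hsd : Γ = dualCode Γ) :
    2 ∣ n := by
  have h1 : (1 : Fin n → ZMod 2) ∈ dualCode Γ := by
    intro c hc
    simp only [Pi.one_apply, one_mul]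
    rw [ms_sum_eq]
    exact (ZMod.natCast_eq_zero_iff _ _).mpr (ms_even Γ hsd c hc)
  rw [← hsd] at h1
  have := ms_even Γ hsd 1 h1
  have hw : wt (1 : Fin n → ZMod 2) = n := by rw [ms_wt]; simp
  rwa [hw] at this

open Classical in
theorem ms_final {N : ℕ} (hN : 0 < N) (Γ : Submodule (ZMod 2) (Fin (2 * N) → ZMod 2))
    (hsd : Γ = dualCode Γ) (hmin : ∀ c ∈ Γ, c ≠ 0 → 2 * (N / 4) + 2 < wt c) : False := by
  set G := Finset.univ.filter (fun c => c ∈ Γ) with hG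
  have hmem : ∀ c, c ∈ G ↔ c ∈ Γ := by intro c; simp [hG]
  have hMW : ∀ x y, msF Γ (x + y) (x - y) = (G.card : ℝ) * msF Γ x y := by
    intro x y
    have := ms_macwilliams Γ x y
    rw [← hsd] at this
    exact this
  have hcard : (G.card : ℝ) = 2 ^ N := by
    have h1 := hMW (1 + 0) (1 - 0)
    rw [hMW 1 0, ms_F_one_zero] at h1
    have h2 := ms_F_scale Γ 2 1 0
    rw [ms_F_one_zero] at h2
    have e1 : (1 : ℝ) + 0 + (1 - 0) = 2 * 1 := by ring
    have e2 : (1 : ℝ) + 0 - (1 - 0) = 2 * 0 := by ring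
    rw [e1, e2, h2] at h1
    have : (G.card : ℝ) ^ 2 = (2 ^ N) ^ 2 := by
      rw [← pow_mul, mul_comm N 2]; linarith
    exact (pow_left_inj₀ (Nat.cast_nonneg _) (pow_nonneg zero_le_two _) two_ne_zero).mp this
  have hwe : ∀ c ∈ G, ∃ e, e ≤ N ∧ wt c = 2 * e := by
    intro c hc
    obtain ⟨e, he⟩ := ms_even Γ hsd c ((hmem c).mp hc)
    exact ⟨e, by have := ms_wt_le c; omega, he⟩
  -- the polynomial in the variable x^2 - y^2
  set g : ℝ[X] := ∑ c ∈ G, (C (1 / 2) * (1 + X)) ^ (N - wt c / 2) * (C (1 / 2) * (1 - X)) ^ (wt c / 2)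
    with hg
  have hgF : ∀ x y : ℝ, x ^ 2 + y ^ 2 = 1 → g.eval (x ^ 2 - y ^ 2) = msF Γ x y := by
    intro x y hxy
    rw [hg, eval_finsetSum]
    unfold msF
    apply Finset.sum_congr rfl
    intro c hc
    obtain ⟨e, he, hw⟩ := hwe c hc
    rw [hw]
    have e1 : 2 * e / 2 = e := by omega
    have e2 : 2 * N - 2 * e = 2 * (N - e) := by omega
    rw [e1, e2, pow_mul, pow_mul]
    simp only [eval_mul, eval_pow, eval_C, eval_add, eval_sub, eval_one, eval_X]
    congr 2
    · linarith
    · linarith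
  have hsym : ∀ θ : ℝ, g.eval (Real.cos θ) = g.eval (Real.sin θ) := by
    intro θ
    set x := Real.cos (θ / 2)
    set y := Real.sin (θ / 2)
    have hxy : x ^ 2 + y ^ 2 = 1 := by have := Real.sin_sq_add_cos_sq (θ / 2); linarith
    have hc : Real.cos θ = x ^ 2 - y ^ 2 := by
      have := Real.cos_two_mul' (θ / 2)
      rwa [show 2 * (θ / 2) = θ by ring] at this
    have hs : Real.sin θ = 2 * y * x := by
      have := Real.sin_two_mul (θ / 2)
      rwa [show 2 * (θ / 2) = θ by ring] at this
    set r := Real.sqrt (1 / 2)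
    have hr : r ^ 2 = 1 / 2 := Real.sq_sqrt (by norm_num)
    have h1 : (r * (x + y)) ^ 2 + (r * (x - y)) ^ 2 = 1 := by
      rw [mul_pow, mul_pow, hr]; linarith
    have h2 := hgF _ _ h1
    have h3 : (r * (x + y)) ^ 2 - (r * (x - y)) ^ 2 = Real.sin θ := by
      rw [mul_pow, mul_pow, hr, hs]; ring
    rw [h3, ms_F_scale, hMW, hcard, pow_mul, hr, ← mul_assoc, ← mul_pow] at h2
    norm_num at h2
    rw [h2, hc, hgF x y hxy]
  obtain ⟨P, hP⟩ := ms_gleason g hsym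
  have hgdeg : g.natDegree ≤ N := by
    rw [hg]
    apply natDegree_sum_le_of_forall_le
    intro c hc
    obtain ⟨e, he, hw⟩ := hwe c hc
    have e1 : 2 * e / 2 = e := by omega
    rw [hw, e1]
    have d1 : (C (1 / 2 : ℝ) * (1 + X)).natDegree ≤ 1 := by compute_degree
    have d2 : (C (1 / 2 : ℝ) * (1 - X)).natDegree ≤ 1 := by compute_degree
    refine natDegree_mul_le.trans ?_
    have := natDegree_pow_le_of_le (N - e) d1
    have := natDegree_pow_le_of_le e d2
    omega
  have hPdeg : P.natDegree ≤ N / 4 := by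
    have hq : (X ^ 2 * (1 - X ^ 2) : ℝ[X]).natDegree = 4 := by
      have : (X ^ 2 * (1 - X ^ 2) : ℝ[X]) = -X ^ 4 + X ^ 2 := by ring
      rw [this]; compute_degree!
    rw [hP, natDegree_comp, hq] at hgdeg
    omega
  set m := N / 4 with hm
  -- the polynomial identity in z
  have hpoly : (∑ c ∈ G, X ^ (wt c / 2) : ℝ[X]) = ∑ j ∈ Finset.range (m + 1),
      C (P.coeff j * 4 ^ j) * ((X * (1 - X) ^ 2) ^ j * (1 + X) ^ (N - 4 * j)) := by
    apply eq_of_infinite_eval_eq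
    refine (Set.Ici_infinite (0 : ℝ)).mono ?_
    intro z hz
    have hz0 : (0 : ℝ) ≤ z := hz
    have hz1 : (1 + z) ≠ 0 := by positivity
    have k1 : g.eval ((1 - z) / (1 + z)) * (1 + z) ^ N = ∑ c ∈ G, z ^ (wt c / 2) := by
      rw [hg, eval_finsetSum, Finset.sum_mul]
      apply Finset.sum_congr rfl
      intro c hc
      obtain ⟨e, he, hw⟩ := hwe c hc
      have e1 : 2 * e / 2 = e := by omega
      rw [hw, e1]
      simp only [eval_mul, eval_pow, eval_C, eval_add, eval_sub, eval_one, eval_X]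
      have a1 : (1 / 2 : ℝ) * (1 + (1 - z) / (1 + z)) = 1 / (1 + z) := by field_simp; ring
      have a2 : (1 / 2 : ℝ) * (1 - (1 - z) / (1 + z)) = z / (1 + z) := by field_simp; ring
      have a3 : (1 + z) ^ N = (1 + z) ^ (N - e) * (1 + z) ^ e := by
        rw [← pow_add, Nat.sub_add_cancel he]
      rw [a1, a2, a3, div_pow, div_pow]
      field_simp
      simp
    simp only [Set.mem_ofPred_eq, eval_finsetSum, eval_mul, eval_pow, eval_C, eval_add, eval_sub,
      eval_one, eval_X]
    rw [← k1, hP, eval_comp, eval_eq_sum_range' (Nat.lt_succ_of_le hPdeg), Finset.sum_mul]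
    apply Finset.sum_congr rfl
    intro j hj
    have hj' : j < m + 1 := Finset.mem_range.mp hj
    have a3 : (1 + z) ^ N = (1 + z) ^ (N - 4 * j) * ((1 + z) ^ 4) ^ j := by
      rw [← pow_mul, ← pow_add, Nat.sub_add_cancel (by omega)]
    simp only [eval_mul, eval_pow, eval_sub, eval_one, eval_X]
    have a4 : ((1 - z) / (1 + z)) ^ 2 * (1 - ((1 - z) / (1 + z)) ^ 2)
        = 4 * (z * (1 - z) ^ 2) / (1 + z) ^ 4 := by field_simp; ring
    rw [a4, a3, div_pow, mul_pow]
    field_simp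
  have hsplit : ∃ R : ℝ[X], (∑ c ∈ G, X ^ (wt c / 2) : ℝ[X]) = 1 + X ^ (m + 2) * R := by
    have h0 : (0 : Fin (2 * N) → ZMod 2) ∈ G := (hmem 0).mpr Γ.zero_mem
    refine ⟨∑ c ∈ G.erase 0, X ^ (wt c / 2 - (m + 2)), ?_⟩
    rw [← Finset.add_sum_erase G _ h0, (ms_wt_zero_iff (0 : Fin (2 * N) → ZMod 2)).mpr rfl,
      Finset.mul_sum]
    refine congrArg₂ (· + ·) (by simp) ?_
    apply Finset.sum_congr rfl
    intro c hc
    have hc' := Finset.mem_erase.mp hc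
    obtain ⟨e, he, hw⟩ := hwe c hc'.2
    have := hmin c ((hmem c).mp hc'.2) hc'.1
    rw [← pow_add]; congr 1; omega
  obtain ⟨R, hR⟩ := hsplit
  rw [hR] at hpoly
  have hps := congrArg (Polynomial.coeToPowerSeries.ringHom (R := ℝ)) hpoly
  simp only [map_add, map_mul, map_pow, map_sum, map_one, map_sub,
    Polynomial.coeToPowerSeries.ringHom_apply, Polynomial.coe_X, Polynomial.coe_C] at hps
  refine ms_core N m hN (by omega) (by omega) (fun j => P.coeff j * 4 ^ j) (R : PowerSeries ℝ) ?_
  rw [hps]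
  simp

/-- Mallows–Sloane, Type I: a binary self-dual code satisfies
`d ≤ 2⌊n/8⌋ + 2`. -/
theorem stmt_12 {n : ℕ} (hn : 0 < n) (Γ : Submodule (ZMod 2) (Fin n → ZMod 2))
    (hsd : Γ = dualCode Γ) :
    minDist Γ ≤ 2 * (n / 8) + 2 := by
  obtain ⟨N, rfl⟩ := ms_n_even Γ hsd
  by_contra hcon
  have hdiv : 2 * N / 8 = N / 4 := by omega
  rw [hdiv] at hcon
  refine ms_final (N := N) (by omega) Γ hsd ?_
  intro c hc hc0
  have : minDist Γ ≤ wt c := Nat.sInf_le ⟨c, hc, hc0, rfl⟩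
  omega

end
end
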